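/- Let h be a hyperexponential term given in standard form h = c0·exp(a/b)·∏_{ℓ=1}^L c_ℓ^{e_ℓ} satisfying the nondegeneracy assumptions, and suppose deg_x a ≤ deg_x b. Set ψ = γ + φ3 − 2, ϑ = α·(2γ−1+φ3) − 1, and φ = deg_x c0 + α·deg_y c0 + (γ−2+φ3)·(deg_x c0 + 1 − α) − (1/2)·max{γ−2+φ3, 0}·(γ+1+φ3). Then for all integers r and d with r ≥ ψ + 1 and d > (ϑ·r + φ)/(r − ψ), there exists a creative telescoping relation for h of order at most r and degree at most d. -/

import Mathlib

open Polynomial Finset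

/-- The derivative with respect to `y` on `K[y][x]`
(we represent bivariate polynomials as `Polynomial (Polynomial K)`,
the *outer* variable being `x`, the *inner* variable being `y`). -/
noncomputable def DY {K : Type*} [CommRing K] (p : Polynomial (Polynomial K)) :
    Polynomial (Polynomial K) :=
  p.sum fun n a => Polynomial.C (Polynomial.derivative a) * Polynomial.X ^ n

/-- The degree with respect to `y` of an element of `K[y][x]`. -/
noncomputable def degY {K : Type*} [CommRing K] (p : Polynomial (Polynomial K)) : ℕ :=
  p.support.sup fun n => (p.coeff n).natDegree

/-- The embedding of `K[x]` into `K[y][x]` (polynomials free of `y`). -/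
noncomputable def liftX {K : Type*} [CommRing K] (p : Polynomial K) :
    Polynomial (Polynomial K) :=
  p.map (Polynomial.C : K →+* Polynomial K)

/-- The falling factorial `z(z-1)⋯(z-n+1)` of an element of `K`. -/
noncomputable def ffall {K : Type*} [Field K] (z : K) (n : ℕ) : K :=
  ∏ j ∈ Finset.range n, (z - (j : K))

section Bivariate

variable {K : Type*} [Field K]

/-- Partial differentiation with respect to the outer variable. -/
noncomputable def dX : Derivation K K[X][X] K[X][X] :=
  (Polynomial.derivative' (R := K[X])).restrictScalars K

/-- Partial differentiation with respect to the inner variable. -/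
noncomputable def dY : Derivation K K[X][X] K[X][X] :=
  Derivation.mk'
    ((Bivariate.swap (R := K)).toLinearMap ∘ₗ
      (dX : Derivation K K[X][X] K[X][X]).toLinearMap ∘ₗ (Bivariate.swap (R := K)).toLinearMap)
    (fun a b => by
      simp [Derivation.leibniz, Bivariate.swap_swap_apply])

theorem dY_apply (p : K[X][X]) :
    dY p = Bivariate.swap (derivative (Bivariate.swap p)) := rfl

theorem swap_dY (p : K[X][X]) :
    Bivariate.swap (dY p) = derivative (Bivariate.swap p) := by
  rw [dY_apply, Bivariate.swap_swap_apply]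

theorem swap_ne_zero {p : K[X][X]} (hp : p ≠ 0) : Bivariate.swap p ≠ 0 := by
  simpa using hp

theorem coeff_coeff_swap (p : K[X][X]) (i j : ℕ) :
    ((Bivariate.swap p).coeff j).coeff i = (p.coeff i).coeff j := by
  induction p using Polynomial.induction_on' with
  | add p q hp hq => simp [hp, hq]
  | monomial n f =>
    induction f using Polynomial.induction_on' with
    | add p q hp hq => simp only [map_add, coeff_add, hp, hq]
    | monomial m k =>
      rw [Bivariate.swap_monomial_monomial]
      simp only [coeff_monomial]
      split_ifs <;> simp [coeff_monomial, *]

theorem natDegree_swap_le_iff (p : K[X][X]) (n : ℕ) :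
    (Bivariate.swap p).natDegree ≤ n ↔ ∀ i, (p.coeff i).natDegree ≤ n := by
  simp only [natDegree_le_iff_coeff_eq_zero]
  constructor
  · intro h i N hN
    rw [← coeff_coeff_swap, h N hN, coeff_zero]
  · intro h N hN
    ext i
    rw [coeff_coeff_swap, h i N hN, coeff_zero]

theorem degY_eq_natDegree_swap (p : K[X][X]) : degY p = (Bivariate.swap p).natDegree := by
  apply le_antisymm
  · exact Finset.sup_le fun i _ => (natDegree_swap_le_iff p _).1 le_rfl i
  · rw [natDegree_swap_le_iff]
    intro i
    by_cases hi : i ∈ p.support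
    · exact Finset.le_sup (f := fun n => (p.coeff n).natDegree) hi
    · simp [notMem_support_iff.1 hi]

theorem DY_eq_dY (p : K[X][X]) : DY p = dY p := by
  have hDY : ∀ i, (DY p).coeff i = derivative (p.coeff i) := by
    intro i
    simp only [DY, Polynomial.sum, finsetSum_coeff, coeff_C_mul, coeff_X_pow, mul_ite, mul_one,
      mul_zero, Finset.sum_ite_eq]
    split_ifs with h
    · rfl
    · rw [notMem_support_iff.1 h, derivative_zero]
  ext i j
  rw [hDY, dY_apply, coeff_coeff_swap, coeff_derivative, coeff_derivative, ← coeff_coeff_swap p]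
  rw [← Nat.cast_succ, ← Nat.cast_succ, ← nsmul_eq_mul', ← nsmul_eq_mul', coeff_smul]

theorem natDegree_X_mul_derivative_le {R : Type*} [CommRing R] (p : R[X]) :
    (X * derivative p).natDegree ≤ p.natDegree := by
  rw [natDegree_le_iff_coeff_eq_zero]
  rintro (_ | N) hN
  · simp
  · rw [coeff_X_mul, coeff_derivative, coeff_eq_zero_of_natDegree_lt hN, zero_mul]

theorem coeff_X_mul_derivative {R : Type*} [CommRing R] (p : R[X]) (n : ℕ) :
    (X * derivative p).coeff n = n * p.coeff n := by
  cases n with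
  | zero => simp
  | succ n => rw [coeff_X_mul, coeff_derivative]; push_cast; ring

theorem natDegree_X_mul_derivative [CharZero K] (p : K[X][X]) (hp : 0 < p.natDegree) :
    X * derivative p ≠ 0 ∧ (X * derivative p).natDegree = p.natDegree := by
  have h : (X * derivative p).coeff p.natDegree ≠ 0 := by
    rw [coeff_X_mul_derivative]
    refine mul_ne_zero (by exact_mod_cast hp.ne') ?_
    rw [coeff_natDegree, leadingCoeff_ne_zero]
    rintro rfl
    simp at hp
  exact ⟨fun h0 => h (by simp [h0]),
    le_antisymm (natDegree_X_mul_derivative_le p) (le_natDegree_of_ne_zero h)⟩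

theorem natDegree_swap_derivative_le (p : K[X][X]) :
    (Bivariate.swap (derivative p)).natDegree ≤ (Bivariate.swap p).natDegree := by
  rw [natDegree_swap_le_iff]
  intro i
  rw [coeff_derivative]
  refine (natDegree_mul_le).trans ?_
  rw [← Nat.cast_succ, natDegree_natCast, add_zero]
  exact (natDegree_swap_le_iff p _).1 le_rfl _

theorem natDegree_dY_le (p : K[X][X]) : (dY p).natDegree ≤ p.natDegree := by
  simpa [dY_apply, Bivariate.swap_swap_apply] using
    natDegree_swap_derivative_le (Bivariate.swap p)

theorem natDegree_add_one_le_of_X_mul {R : Type*} [CommRing R] {p : R[X]} {n : ℕ}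
    (h : (X * p).natDegree ≤ n) {i : ℕ} (hi : n ≤ i) : p.coeff i = 0 := by
  rw [← coeff_X_mul]
  exact coeff_eq_zero_of_natDegree_lt (by omega)

theorem exists_liftX_of_natDegree_swap_eq_zero (p : K[X][X])
    (hp : (Bivariate.swap p).natDegree = 0) : ∃ p', p = liftX p' := by
  refine ⟨(Bivariate.swap p).coeff 0, ?_⟩
  rw [liftX, ← Bivariate.swap_C, ← eq_C_of_natDegree_eq_zero hp, Bivariate.swap_swap_apply]

theorem natDegree_swap_mul {p q : K[X][X]} (hp : p ≠ 0) (hq : q ≠ 0) :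
    (Bivariate.swap (p * q)).natDegree =
      (Bivariate.swap p).natDegree + (Bivariate.swap q).natDegree := by
  rw [map_mul, natDegree_mul (swap_ne_zero hp) (swap_ne_zero hq)]

/-- An element of positive inner degree has a prime factor of positive inner degree. -/
theorem exists_prime_dvd_natDegree_swap_pos (p : K[X][X]) (hp : p ≠ 0)
    (hdeg : 0 < (Bivariate.swap p).natDegree) :
    ∃ q, Prime q ∧ q ∣ p ∧ 0 < (Bivariate.swap q).natDegree := by
  induction p using UniqueFactorizationMonoid.induction_on_prime with
  | h₁ => exact absurd rfl hp
  | h₂ x hx =>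
    have hu : IsUnit (Bivariate.swap x) := IsUnit.map (Bivariate.swap (R := K)).toRingEquiv hx
    exact absurd (natDegree_eq_zero_of_isUnit hu) hdeg.ne'
  | h₃ x q hx hq ih =>
    rw [natDegree_swap_mul hq.ne_zero hx] at hdeg
    by_cases h : 0 < (Bivariate.swap q).natDegree
    · exact ⟨q, hq, dvd_mul_right _ _, h⟩
    · obtain ⟨q', h1, h2, h3⟩ := ih hx (by omega)
      exact ⟨q', h1, h2.mul_left _, h3⟩

theorem not_dvd_dY [CharZero K] {q : K[X][X]} (hq : 0 < (Bivariate.swap q).natDegree) :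
    ¬ q ∣ dY q := by
  intro h
  obtain ⟨h0, h1⟩ := natDegree_X_mul_derivative _ hq
  have h2 : Bivariate.swap q ∣ derivative (Bivariate.swap q) := by
    obtain ⟨k, hk⟩ := h
    exact ⟨Bivariate.swap k, by rw [← swap_dY, hk, map_mul]⟩
  have h3 := natDegree_le_of_dvd h2 (right_ne_zero_of_mul h0)
  have h4 := natDegree_derivative_lt hq.ne'
  omega

end Bivariate

section LogDerivative

variable {K : Type*} [Field K]

/-- If every prime factor of `b` divides `s`, then `b` divides `s * D b`. -/
theorem dvd_mul_derivation {A : Type*} [CommRing A] [IsDomain A] [UniqueFactorizationMonoid A]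
    [Algebra K A] (D : Derivation K A A) (s b : A) (h : ∀ q, Prime q → q ∣ b → q ∣ s) :
    b ∣ s * D b := by
  induction b using UniqueFactorizationMonoid.induction_on_coprime with
  | h0 => simp
  | h1 hx => exact hx.dvd
  | hpr n hq =>
    rename_i q
    rcases n with _ | n
    · simp
    · obtain ⟨k, rfl⟩ := h q hq (dvd_pow_self q (Nat.succ_ne_zero n))
      rw [D.leibniz_pow]
      simp only [Nat.add_sub_cancel, smul_eq_mul, nsmul_eq_mul]
      exact ⟨k * ((n + 1 : ℕ) : A) * D q, by ring⟩
  | hcp hxy ihx ihy =>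
    rename_i x y
    obtain ⟨u, hu⟩ := ihx fun q hq hd => h q hq (hd.mul_right y)
    obtain ⟨v, hv⟩ := ihy fun q hq hd => h q hq (hd.mul_left x)
    rw [D.leibniz]
    simp only [smul_eq_mul]
    exact ⟨u + v, by linear_combination y * hu + x * hv⟩

/-- The numerator over `b * s * ∏ c` of the logarithmic `D`-derivative of `exp (a / b) * ∏ c ^ e`,
where `B` stands for `s * D b / b`. -/
noncomputable def logNum {L : ℕ} (D : K[X][X] → K[X][X]) (B a b s : K[X][X])
    (c : Fin L → K[X][X]) (e : Fin L → K) : K[X][X] :=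
  (D a * s - a * B) * ∏ ℓ, c ℓ +
    b * s * ∑ ℓ, e ℓ • (D (c ℓ) * ∏ j ∈ Finset.univ.erase ℓ, c j)

variable {L : ℕ} {B a b s : K[X][X]} {c : Fin L → K[X][X]} {e : Fin L → K}

theorem logNum_mul_left (m : K[X][X]) (D : K[X][X] → K[X][X]) :
    logNum (fun p => m * D p) (m * B) a b s c e = m * logNum D B a b s c e := by
  have h : ∑ ℓ, e ℓ • (m * D (c ℓ) * ∏ j ∈ Finset.univ.erase ℓ, c j) =
      m * ∑ ℓ, e ℓ • (D (c ℓ) * ∏ j ∈ Finset.univ.erase ℓ, c j) := by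
    rw [Finset.mul_sum]
    refine Finset.sum_congr rfl fun i _ => ?_
    rw [mul_smul_comm, mul_assoc]
  rw [logNum, logNum, h]
  ring

theorem swap_logNum (D : K[X][X] → K[X][X]) :
    Bivariate.swap (logNum D B a b s c e) =
      logNum (fun p => Bivariate.swap (D (Bivariate.swap p))) (Bivariate.swap B)
        (Bivariate.swap a) (Bivariate.swap b) (Bivariate.swap s)
        (fun ℓ => Bivariate.swap (c ℓ)) e := by
  simp only [logNum, map_add, map_mul, map_sub, map_sum, map_smul, map_prod,
    Bivariate.swap_swap_apply]

theorem natDegree_le_of_mul_eq {D : K[X][X] → K[X][X]} (hD : ∀ p, (D p).natDegree ≤ p.natDegree)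
    (hb : b ≠ 0) (hB : b * B = s * D b) : B.natDegree ≤ s.natDegree := by
  by_cases hB0 : B = 0
  · simp [hB0]
  · have h1 := natDegree_mul hb hB0
    have h2 : (s * D b).natDegree ≤ s.natDegree + b.natDegree :=
      natDegree_mul_le_of_le le_rfl (hD b)
    rw [← hB] at h2
    omega

theorem natDegree_mul_prod_erase_le {D : K[X][X] → K[X][X]}
    (hD : ∀ p, (D p).natDegree ≤ p.natDegree) (ℓ : Fin L) :
    (D (c ℓ) * ∏ j ∈ Finset.univ.erase ℓ, c j).natDegree ≤ ∑ ℓ, (c ℓ).natDegree := by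
  rw [← Finset.add_sum_erase _ _ (Finset.mem_univ ℓ)]
  exact natDegree_mul_le_of_le (hD _) (natDegree_prod_le _ _)

theorem natDegree_logSum_le {D : K[X][X] → K[X][X]} (hD : ∀ p, (D p).natDegree ≤ p.natDegree) :
    (∑ ℓ, e ℓ • (D (c ℓ) * ∏ j ∈ Finset.univ.erase ℓ, c j)).natDegree ≤
      ∑ ℓ, (c ℓ).natDegree :=
  natDegree_sum_le_of_forall_le _ _ fun ℓ _ =>
    (natDegree_smul_le _ _).trans (natDegree_mul_prod_erase_le hD ℓ)

theorem natDegree_logNum_le {D : K[X][X] → K[X][X]} (hD : ∀ p, (D p).natDegree ≤ p.natDegree)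
    (hb : b ≠ 0) (hB : b * B = s * D b) :
    (logNum D B a b s c e).natDegree ≤
      s.natDegree + max a.natDegree b.natDegree + ∑ ℓ, (c ℓ).natDegree := by
  have hBd := natDegree_le_of_mul_eq hD hb hB
  refine natDegree_add_le_of_degree_le
    (natDegree_mul_le_of_le ((natDegree_sub_le _ _).trans (max_le ?_ ?_)) (natDegree_prod_le _ _))
    (natDegree_mul_le_of_le ?_ (natDegree_logSum_le hD))
  · exact (natDegree_mul_le_of_le (hD a) le_rfl).trans (by omega)
  · exact (natDegree_mul_le_of_le le_rfl hBd).trans (by omega)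
  · exact natDegree_mul_le.trans (by omega)

theorem coeff_prod_sum_natDegree {R ι : Type*} [CommRing R] (t : Finset ι) (f : ι → R[X]) :
    (∏ i ∈ t, f i).coeff (∑ i ∈ t, (f i).natDegree) = ∏ i ∈ t, (f i).leadingCoeff := by
  classical
  induction t using Finset.induction_on with
  | empty => simp
  | insert i t hi ih =>
    rw [Finset.prod_insert hi, Finset.sum_insert hi, Finset.prod_insert hi,
      coeff_mul_add_eq_of_natDegree_le le_rfl (natDegree_prod_le _ _), ih, coeff_natDegree]

/-- The leading behaviour in the outer variable when `a / b` has nonpositive degree. -/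
theorem coeff_X_mul_logNum (hb : b ≠ 0) (hB : b * B = s * derivative b)
    (hab : a.natDegree ≤ b.natDegree) :
    (X * logNum derivative B a b s c e).coeff
        (s.natDegree + b.natDegree + ∑ ℓ, (c ℓ).natDegree) =
      (∑ ℓ, e ℓ * ((c ℓ).natDegree : K)) •
        (b * s * ∏ ℓ, c ℓ).coeff (s.natDegree + b.natDegree + ∑ ℓ, (c ℓ).natDegree) := by
  have hD : ∀ p : K[X][X], ((fun p => X * derivative p) p).natDegree ≤ p.natDegree :=
    natDegree_X_mul_derivative_le
  have hB' : b * (X * B) = s * (X * derivative b) := by linear_combination X * hB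
  have hBd := natDegree_le_of_mul_eq hD hb hB'
  have hBc : (X * B).coeff s.natDegree = b.natDegree * s.coeff s.natDegree := by
    have h : (b * (X * B)).coeff (b.natDegree + s.natDegree) =
        (s * (X * derivative b)).coeff (b.natDegree + s.natDegree) := by rw [hB']
    rw [coeff_mul_add_eq_of_natDegree_le le_rfl hBd, add_comm b.natDegree,
      coeff_mul_add_eq_of_natDegree_le le_rfl (hD b), coeff_X_mul_derivative] at h
    have hbc : b.coeff b.natDegree ≠ 0 := by simpa using hb
    apply mul_left_cancel₀ hbc
    linear_combination h
  rw [← logNum_mul_left, logNum, coeff_add]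
  have h1 : ((X * derivative a * s - a * (X * B)) * ∏ ℓ, c ℓ).coeff
      (s.natDegree + b.natDegree + ∑ ℓ, (c ℓ).natDegree) = 0 := by
    rw [add_comm s.natDegree, coeff_mul_add_eq_of_natDegree_le ((natDegree_sub_le _ _).trans (max_le
      (natDegree_mul_le_of_le ((natDegree_X_mul_derivative_le a).trans hab) le_rfl)
      (natDegree_mul_le_of_le hab hBd))) (natDegree_prod_le _ _), coeff_sub,
      coeff_mul_add_eq_of_natDegree_le ((natDegree_X_mul_derivative_le a).trans hab) le_rfl,
      coeff_mul_add_eq_of_natDegree_le hab hBd, hBc, coeff_X_mul_derivative]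
    ring
  have h2 : (∑ ℓ, e ℓ • (X * derivative (c ℓ) * ∏ j ∈ Finset.univ.erase ℓ, c j)).coeff
      (∑ ℓ, (c ℓ).natDegree) =
      (∑ ℓ, e ℓ * ((c ℓ).natDegree : K)) • (∏ ℓ, c ℓ).coeff (∑ ℓ, (c ℓ).natDegree) := by
    rw [finsetSum_coeff, Finset.sum_smul]
    refine Finset.sum_congr rfl fun ℓ _ => ?_
    rw [coeff_smul, mul_smul, coeff_prod_sum_natDegree, ← Finset.add_sum_erase _ _ (Finset.mem_univ ℓ),
      coeff_mul_add_eq_of_natDegree_le (hD _) (natDegree_prod_le _ _), coeff_X_mul_derivative,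
      coeff_prod_sum_natDegree, ← Finset.mul_prod_erase _ _ (Finset.mem_univ ℓ), coeff_natDegree,
      Nat.cast_smul_eq_nsmul, nsmul_eq_mul, mul_assoc]
  rw [h1, zero_add, add_comm s.natDegree, coeff_mul_add_eq_of_natDegree_le natDegree_mul_le
    (natDegree_logSum_le hD), coeff_mul_add_eq_of_natDegree_le natDegree_mul_le (natDegree_prod_le _ _),
    h2, mul_smul_comm]

/-- Clearing the spurious factor `b` in the logarithmic derivative of `c₀ * H`. -/
theorem derivation_div_mul_eq {E : Type*} [Field E] (Δ : Derivation ℤ E E) (ι : K[X][X] →+* E)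
    (hinj : Function.Injective ι) (D : K[X][X] → K[X][X]) (hD : ∀ q, Δ (ι q) = ι (D q))
    {c0 : K[X][X]} (hc0 : c0 ≠ 0) (hb : b ≠ 0) (hB : b * B = s * D b) {h : E}
    (hh : Δ h * ι (c0 * b ^ 2 * ∏ ℓ, c ℓ) =
      h * ι (D c0 * b ^ 2 * (∏ ℓ, c ℓ) + (D a * b - a * D b) * c0 * (∏ ℓ, c ℓ) +
        c0 * b ^ 2 * ∑ ℓ, e ℓ • (D (c ℓ) * ∏ j ∈ Finset.univ.erase ℓ, c j))) :
    Δ (h / ι c0) * ι (b * s * ∏ ℓ, c ℓ) = h / ι c0 * ι (logNum D B a b s c e) := by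
  have hιc0 : ι c0 ≠ 0 := (map_ne_zero_iff ι hinj).2 hc0
  have hιb : ι b ≠ 0 := (map_ne_zero_iff ι hinj).2 hb
  have hBι := congrArg ι hB
  rw [Derivation.leibniz_div, hD]
  simp only [logNum, map_mul, map_add, map_sub, map_pow, smul_eq_mul] at hh hBι ⊢
  generalize ι (∑ ℓ, e ℓ • (D (c ℓ) * ∏ j ∈ Finset.univ.erase ℓ, c j)) = S at hh ⊢
  generalize ι (∏ ℓ, c ℓ) = P at hh ⊢
  field_simp
  apply mul_left_cancel₀ hιb
  linear_combination ι s * hh + h * P * ι a * ι c0 * hBι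

end LogDerivative

section Iterates

variable {K : Type*} [Field K]

/-- The numerators of the iterated outer derivatives of `c₀ * H` when `∂H / H = M / G`. -/
noncomputable def iterNum (c0 G M : K[X][X]) : ℕ → K[X][X]
  | 0 => c0
  | i + 1 => derivative (iterNum c0 G M i) * G - (i : K[X][X]) * iterNum c0 G M i * derivative G +
      iterNum c0 G M i * M

/-- The numerator of the inner derivative of `Y * H / G ^ (r - 1)` when `∂H / H = M / G`. -/
noncomputable def innerNum (G M : K[X][X]) (r : ℕ) : K[X][X] →ₗ[K] K[X][X] :=
  LinearMap.mulLeft K G ∘ₗ (dY : Derivation K K[X][X] K[X][X]).toLinearMap +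
    LinearMap.mulLeft K ((1 - (r : K[X][X])) * dY G + M)

theorem innerNum_apply (G M : K[X][X]) (r : ℕ) (Y : K[X][X]) :
    innerNum G M r Y = G * dY Y + ((1 - (r : K[X][X])) * dY G + M) * Y := rfl

/-- The differential equations of `H` together with the degree bounds of their coefficients. -/
structure LogData {E : Type*} [Field E] (Δx Δy : Derivation ℤ E E) (ι : K[X][X] →+* E) (H : E)
    (G Mx My : K[X][X]) (α γ : ℕ) : Prop where
  ne_zero : G ≠ 0
  eqx : Δx H * ι G = H * ι Mx
  eqy : Δy H * ι G = H * ι My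
  degx_G : G.natDegree ≤ α
  degx_Mx : (X * Mx).natDegree ≤ α
  degx_My : My.natDegree ≤ α
  degy_G : (Bivariate.swap G).natDegree ≤ γ
  degy_Mx : (Bivariate.swap Mx).natDegree ≤ γ
  degy_My : (X * Bivariate.swap My).natDegree ≤ γ
  lead : ∃ lam : K, (X * Mx).coeff α = lam • G.coeff α

theorem iterate_mul_pow {E : Type*} [Field E] {Δ : Derivation ℤ E E} {ι : K[X][X] →+* E}
    (hinj : Function.Injective ι) (hΔ : ∀ q, Δ (ι q) = ι (derivative q)) {H : E}
    {c0 G M : K[X][X]} (hG : G ≠ 0) (hH : Δ H * ι G = H * ι M) (i : ℕ) :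
    Δ^[i] (ι c0 * H) * ι G ^ i = ι (iterNum c0 G M i) * H := by
  have hιG : ι G ≠ 0 := (map_ne_zero_iff ι hinj).2 hG
  induction i with
  | zero => simp [iterNum]
  | succ i ih =>
    have h := congrArg Δ ih
    rw [Function.iterate_succ_apply', iterNum]
    simp only [Derivation.leibniz, Derivation.leibniz_pow, hΔ, smul_eq_mul, nsmul_eq_mul] at h
    simp only [map_add, map_sub, map_mul, map_natCast]
    have h' : (i : E) * ι G ^ (i - 1) * ι G = i * ι G ^ i := by
      cases i with
      | zero => simp
      | succ i => simp [pow_succ]; ring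
    linear_combination ι G * h - Δ^[i] (ι c0 * H) * ι (derivative G) * h' -
      (i : E) * ι (derivative G) * ih + ι (iterNum c0 G M i) * hH

theorem derivation_innerNum {E : Type*} [Field E] {Δ : Derivation ℤ E E} {ι : K[X][X] →+* E}
    (hinj : Function.Injective ι) (hΔ : ∀ q, Δ (ι q) = ι (dY q)) {H : E}
    {G M : K[X][X]} (hG : G ≠ 0) (hH : Δ H * ι G = H * ι M) (r : ℕ) (Y : K[X][X]) :
    Δ (ι (Y * G) * H / ι G ^ r) * ι G ^ r = ι (innerNum G M r Y) * H := by
  have hιG : ι G ≠ 0 := (map_ne_zero_iff ι hinj).2 hG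
  have h' : (r : E) * ι G ^ (r - 1) * ι G = r * ι G ^ r := by
    cases r with
    | zero => simp
    | succ r => simp [pow_succ]; ring
  rw [Derivation.leibniz_div, innerNum_apply]
  simp only [map_mul, map_add, map_sub, map_one, map_natCast, Derivation.leibniz,
    Derivation.leibniz_pow, hΔ, smul_eq_mul, nsmul_eq_mul]
  field_simp
  linear_combination (ι G ^ r * ι Y) * hH - ι Y * H * ι (dY G) * h'

section Degrees

variable {c0 G M : K[X][X]} {α γ dx dy : ℕ}

theorem natDegree_swap_iterNum_le (hc0 : (Bivariate.swap c0).natDegree ≤ dy)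
    (hG : (Bivariate.swap G).natDegree ≤ γ) (hM : (Bivariate.swap M).natDegree ≤ γ) (i : ℕ) :
    (Bivariate.swap (iterNum c0 G M i)).natDegree ≤ dy + i * γ := by
  induction i with
  | zero => simpa [iterNum] using hc0
  | succ i ih =>
    rw [iterNum, map_add, map_sub, map_mul, map_mul, map_mul, map_mul, map_natCast, add_mul,
      one_mul, ← add_assoc]
    refine natDegree_add_le_of_degree_le ((natDegree_sub_le _ _).trans (max_le ?_ ?_)) ?_
    · exact natDegree_mul_le_of_le ((natDegree_swap_derivative_le _).trans ih) hG
    · refine natDegree_mul_le_of_le ?_ ((natDegree_swap_derivative_le _).trans hG)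
      simpa using natDegree_mul_le_of_le (natDegree_natCast i).le ih
    · exact natDegree_mul_le_of_le ih hM

theorem X_pow_mul_iterNum_succ (i : ℕ) :
    X ^ (i + 1) * iterNum c0 G M (i + 1) =
      X * derivative (X ^ i * iterNum c0 G M i) * G -
        (i : K[X][X]) * (X ^ i * iterNum c0 G M i) * G -
        (i : K[X][X]) * (X ^ i * iterNum c0 G M i) * (X * derivative G) +
        (X ^ i * iterNum c0 G M i) * (X * M) := by
  have h : X * derivative (X ^ i : K[X][X]) = (i : K[X][X]) * X ^ i := by
    cases i with
    | zero => simp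
    | succ i => rw [derivative_X_pow, Nat.add_sub_cancel, map_natCast]; ring
  rw [iterNum, derivative_mul]
  linear_combination (-iterNum c0 G M i * G) * h

theorem natDegree_X_pow_mul_iterNum (hc0 : c0.natDegree ≤ dx) (hG : G.natDegree ≤ α)
    (hM : (X * M).natDegree ≤ α) {lam : K} (hlam : (X * M).coeff α = lam • G.coeff α) (i : ℕ) :
    (X ^ i * iterNum c0 G M i).natDegree ≤ dx + i * α ∧
      ∃ κ : K, (X ^ i * iterNum c0 G M i).coeff (dx + i * α) =
        κ • (c0.coeff dx * G.coeff α ^ i) := by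
  induction i with
  | zero => exact ⟨by simpa [iterNum] using hc0, 1, by simp [iterNum]⟩
  | succ i ih =>
    obtain ⟨h1, κ, h2⟩ := ih
    rw [X_pow_mul_iterNum_succ]
    generalize X ^ i * iterNum c0 G M i = N at h1 h2 ⊢
    have hN' := (natDegree_X_mul_derivative_le N).trans h1
    have hG' := (natDegree_X_mul_derivative_le G).trans hG
    have hiN : ((i : K[X][X]) * N).natDegree ≤ dx + i * α := by
      simpa using natDegree_mul_le_of_le (natDegree_natCast i).le h1
    have hiNc : ((i : K[X][X]) * N).coeff (dx + i * α) = i * N.coeff (dx + i * α) := by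
      rw [← C_eq_natCast, coeff_C_mul]
    rw [add_mul, one_mul, ← add_assoc]
    constructor
    · refine natDegree_add_le_of_degree_le ((natDegree_sub_le _ _).trans (max_le
        ((natDegree_sub_le _ _).trans (max_le ?_ ?_)) ?_)) ?_
      · exact natDegree_mul_le_of_le hN' hG
      · exact natDegree_mul_le_of_le hiN hG
      · exact natDegree_mul_le_of_le hiN hG'
      · exact natDegree_mul_le_of_le h1 hM
    · refine ⟨(((dx + i * α : ℕ) : K) - i - i * α + lam) * κ, ?_⟩
      rw [coeff_add, coeff_sub, coeff_sub, coeff_mul_add_eq_of_natDegree_le hN' hG,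
        coeff_mul_add_eq_of_natDegree_le hiN hG, coeff_mul_add_eq_of_natDegree_le hiN hG',
        coeff_mul_add_eq_of_natDegree_le h1 hM, coeff_X_mul_derivative, coeff_X_mul_derivative,
        hiNc, h2, hlam]
      simp only [Algebra.smul_def, map_mul, map_add, map_sub, map_natCast]
      ring

end Degrees

theorem natDegree_innerNum_le {G M : K[X][X]} {α : ℕ} (hG : G.natDegree ≤ α)
    (hM : M.natDegree ≤ α) (r : ℕ) (Y : K[X][X]) :
    (innerNum G M r Y).natDegree ≤ α + Y.natDegree := by
  rw [innerNum_apply]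
  have h1 : (1 - (r : K[X][X])).natDegree = 0 := by
    have : (1 - (r : K[X][X])) = ((1 - (r : ℤ) : ℤ) : K[X][X]) := by push_cast; ring
    rw [this, natDegree_intCast]
  refine natDegree_add_le_of_degree_le (natDegree_mul_le_of_le hG (natDegree_dY_le Y))
    (natDegree_mul_le_of_le (natDegree_add_le_of_degree_le ?_ hM) le_rfl)
  simpa using natDegree_mul_le_of_le h1.le ((natDegree_dY_le G).trans hG)

theorem natDegree_X_mul_swap_innerNum_le {G M : K[X][X]} {γ : ℕ}
    (hG : (Bivariate.swap G).natDegree ≤ γ) (hM : (X * Bivariate.swap M).natDegree ≤ γ) (r : ℕ)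
    (Y : K[X][X]) :
    (X * Bivariate.swap (innerNum G M r Y)).natDegree ≤ γ + (Bivariate.swap Y).natDegree := by
  have h1 : (1 - (r : K[X][X])).natDegree = 0 := by
    have : (1 - (r : K[X][X])) = ((1 - (r : ℤ) : ℤ) : K[X][X]) := by push_cast; ring
    rw [this, natDegree_intCast]
  have h : X * Bivariate.swap (innerNum G M r Y) =
      Bivariate.swap G * (X * derivative (Bivariate.swap Y)) +
        ((1 - (r : K[X][X])) * (X * derivative (Bivariate.swap G)) + X * Bivariate.swap M) *
          Bivariate.swap Y := by
    rw [innerNum_apply]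
    simp only [map_add, map_mul, map_sub, map_one, map_natCast, swap_dY]
    ring
  rw [h]
  refine natDegree_add_le_of_degree_le
    (natDegree_mul_le_of_le hG (natDegree_X_mul_derivative_le _))
    (natDegree_mul_le_of_le (natDegree_add_le_of_degree_le ?_ hM) le_rfl)
  simpa using natDegree_mul_le_of_le h1.le ((natDegree_X_mul_derivative_le _).trans hG)

/-- Nonzero elements of the kernel of `innerNum` all have the same inner degree. -/
theorem natDegree_swap_eq_of_innerNum_eq_zero [CharZero K] {G M : K[X][X]} (hG : G ≠ 0) {r : ℕ}
    {Y Z : K[X][X]} (hY0 : Y ≠ 0) (hZ0 : Z ≠ 0) (hY : innerNum G M r Y = 0)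
    (hZ : innerNum G M r Z = 0) :
    (Bivariate.swap Y).natDegree = (Bivariate.swap Z).natDegree := by
  rw [innerNum_apply] at hY hZ
  have h : dY Y * Z = dY Z * Y := by
    apply mul_left_cancel₀ hG
    linear_combination Z * hY - Y * hZ
  have h' := congrArg (fun p => X * Bivariate.swap p) h
  simp only [map_mul, swap_dY, ← mul_assoc] at h'
  have h'' := congrArg
    (coeff · ((Bivariate.swap Y).natDegree + (Bivariate.swap Z).natDegree)) h'
  beta_reduce at h''
  rw [coeff_mul_add_eq_of_natDegree_le (natDegree_X_mul_derivative_le _) le_rfl,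
    add_comm, coeff_mul_add_eq_of_natDegree_le (natDegree_X_mul_derivative_le _) le_rfl,
    coeff_X_mul_derivative, coeff_X_mul_derivative, coeff_natDegree, coeff_natDegree] at h''
  have hlY := leadingCoeff_ne_zero.2 (swap_ne_zero hY0)
  have hlZ := leadingCoeff_ne_zero.2 (swap_ne_zero hZ0)
  have : ((Bivariate.swap Y).natDegree : K[X]) = ((Bivariate.swap Z).natDegree : K[X]) := by
    apply mul_right_cancel₀ (mul_ne_zero hlY hlZ)
    linear_combination h''
  exact_mod_cast this

end Iterates

section LinearAlgebra

variable {K : Type*} [Field K]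

/-- The bivariate polynomial with a given rectangular array of coefficients. -/
noncomputable def polyOfCoeffs (s t : ℕ) : (Fin s → Fin t → K) →ₗ[K] K[X][X] where
  toFun f := ∑ i : Fin s, ∑ j : Fin t, monomial (i : ℕ) (monomial (j : ℕ) (f i j))
  map_add' f g := by simp [Finset.sum_add_distrib]
  map_smul' k f := by simp [Finset.smul_sum, smul_monomial]

theorem coeff_coeff_polyOfCoeffs (s t : ℕ) (f : Fin s → Fin t → K) (i j : ℕ) :
    ((polyOfCoeffs s t f).coeff i).coeff j =
      ∑ i' : Fin s, ∑ j' : Fin t, if (i' : ℕ) = i ∧ (j' : ℕ) = j then f i' j' else 0 := by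
  simp only [polyOfCoeffs, LinearMap.coe_mk, AddHom.coe_mk, finsetSum_coeff, coeff_monomial]
  refine Finset.sum_congr rfl fun i' _ => Finset.sum_congr rfl fun j' _ => ?_
  by_cases hi : (i' : ℕ) = i <;> simp [hi, coeff_monomial]

theorem coeff_polyOfCoeffs_of_le (s t : ℕ) (f : Fin s → Fin t → K) {i : ℕ} (hi : s ≤ i) :
    (polyOfCoeffs s t f).coeff i = 0 := by
  ext j
  rw [coeff_coeff_polyOfCoeffs, coeff_zero]
  refine Finset.sum_eq_zero fun i' _ => Finset.sum_eq_zero fun j' _ => ?_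
  rw [if_neg]
  have := i'.2
  omega

theorem coeff_coeff_polyOfCoeffs_of_le (s t : ℕ) (f : Fin s → Fin t → K) (i : ℕ) {j : ℕ}
    (hj : t ≤ j) : ((polyOfCoeffs s t f).coeff i).coeff j = 0 := by
  rw [coeff_coeff_polyOfCoeffs]
  refine Finset.sum_eq_zero fun i' _ => Finset.sum_eq_zero fun j' _ => ?_
  rw [if_neg]
  have := j'.2
  omega

theorem polyOfCoeffs_injective (s t : ℕ) : Function.Injective (polyOfCoeffs (K := K) s t) := by
  rw [injective_iff_map_eq_zero]
  intro f hf
  ext i j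
  have h := coeff_coeff_polyOfCoeffs s t f i j
  rw [hf, Finset.sum_eq_single i, Finset.sum_eq_single j] at h
  · simpa using h.symm
  · intro j' _ hj'
    rw [if_neg]
    simp [Fin.val_inj, hj']
  · simp
  · intro i' _ hi'
    refine Finset.sum_eq_zero fun j' _ => ?_
    rw [if_neg]
    simp [Fin.val_inj, hi']
  · simp

/-- The coefficients of a bivariate polynomial in a rectangle. -/
noncomputable def coeffBox (s t : ℕ) : K[X][X] →ₗ[K] (Fin s → Fin t → K) where
  toFun p i j := (p.coeff i).coeff j
  map_add' p q := by ext; simp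
  map_smul' k p := by ext; simp

/-- Dimension count for the equation `Φ v = Λ Y` with `Y` ranging over the polynomials of
outer degree `< s` and inner degree `< t`. -/
theorem exists_ne_zero_map_eq {V : Type*} [AddCommGroup V] [Module K V] [FiniteDimensional K V]
    (Φ : V →ₗ[K] K[X][X]) (Λ : K[X][X] →ₗ[K] K[X][X]) (B C s t k : ℕ)
    (hΦx : ∀ v i, B ≤ i → (Φ v).coeff i = 0)
    (hΦy : ∀ v i j, C ≤ j → ((Φ v).coeff i).coeff j = 0)
    (hΛx : ∀ Y : K[X][X], (∀ i, s ≤ i → Y.coeff i = 0) → ∀ i, B ≤ i → (Λ Y).coeff i = 0)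
    (hΛy : ∀ Y : K[X][X], (∀ i j, t ≤ j → (Y.coeff i).coeff j = 0) →
      ∀ i j, C ≤ j → ((Λ Y).coeff i).coeff j = 0)
    (ρ : K[X][X] →ₗ[K] (Fin k → K))
    (hρ : ∀ Y : K[X][X], (∀ i, s ≤ i → Y.coeff i = 0) → Λ Y = 0 → ρ Y = 0 → Y = 0)
    (hcard : B * C + k < Module.finrank K V + s * t) :
    ∃ v ≠ 0, ∃ Y, Φ v = Λ Y := by
  let Ψ : V × (Fin s → Fin t → K) →ₗ[K] (Fin B → Fin C → K) × (Fin k → K) :=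
    LinearMap.prod
      (coeffBox B C ∘ₗ (Φ ∘ₗ LinearMap.fst K V _ - Λ ∘ₗ polyOfCoeffs s t ∘ₗ LinearMap.snd K V _))
      (ρ ∘ₗ polyOfCoeffs s t ∘ₗ LinearMap.snd K V _)
  have hker : LinearMap.ker Ψ ≠ ⊥ := by
    apply LinearMap.ker_ne_bot_of_finrank_lt
    simpa [Module.finrank_pi_fintype] using hcard
  obtain ⟨⟨v, f⟩, hvf, hne⟩ := Submodule.exists_mem_ne_zero_of_ne_bot hker
  have h1 : coeffBox B C (Φ v - Λ (polyOfCoeffs s t f)) = 0 := congrArg Prod.fst hvf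
  have h2 : ρ (polyOfCoeffs s t f) = 0 := congrArg Prod.snd hvf
  have hx := fun i (hi : s ≤ i) => coeff_polyOfCoeffs_of_le s t f hi
  have h3 : Φ v = Λ (polyOfCoeffs s t f) := by
    ext i j
    by_cases hi : i < B
    · by_cases hj : j < C
      · have := congrFun (congrFun h1 ⟨i, hi⟩) ⟨j, hj⟩
        simpa [coeffBox, sub_eq_zero] using this
      · rw [hΦy _ _ _ (not_lt.1 hj), hΛy _ (fun i j hj =>
          coeff_coeff_polyOfCoeffs_of_le s t f i hj) _ _ (not_lt.1 hj)]
    · rw [hΦx _ _ (not_lt.1 hi), hΛx _ hx _ (not_lt.1 hi)]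
  refine ⟨v, ?_, _, h3⟩
  rintro rfl
  rw [map_zero] at h3
  have h4 := hρ _ hx h3.symm h2
  have h5 : f = 0 := polyOfCoeffs_injective s t (by rw [h4, map_zero])
  exact hne (by rw [h5]; rfl)

end LinearAlgebra

section Telescoper

variable {K : Type*} [Field K]

/-- The inclusion of the polynomials in the outer variable as a linear map. -/
noncomputable def liftXLinear : K[X] →ₗ[K] K[X][X] :=
  (mapAlgHom (Algebra.ofId K K[X])).toLinearMap

theorem liftXLinear_apply (p : K[X]) : liftXLinear p = liftX p := rfl

theorem coeff_liftX (p : K[X]) (i : ℕ) : (liftX p).coeff i = C (p.coeff i) := coeff_map _ _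

theorem natDegree_liftX_le (p : K[X]) : (liftX p).natDegree ≤ p.natDegree := natDegree_map_le

theorem natDegree_swap_liftX (p : K[X]) : (Bivariate.swap (liftX p)).natDegree = 0 := by
  rw [liftX, Bivariate.swap_map_C, natDegree_C]

variable {E : Type*} [Field E]

/-- Existence of a creative telescoping relation of order at most `r` and degree at most `d`. -/
def HasTelescoper (Δx Δy : E → E) (ι : K[X][X] →+* E) (h : E) (r d : ℕ) : Prop :=
  ∃ p : ℕ → K[X], (∃ i ≤ r, p i ≠ 0) ∧ (∀ i ≤ r, (p i).natDegree ≤ d) ∧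
    ∃ u v : K[X][X], v ≠ 0 ∧
      ∑ i ∈ Finset.range (r + 1), ι (liftX (p i)) * Δx^[i] h = Δy (ι u * h / ι v)

variable {Δx Δy : Derivation ℤ E E} {ι : K[X][X] →+* E} {H : E} {c0 G Mx My : K[X][X]}
  {α γ γ' dx dy r d : ℕ}

/-- A linear functional which is injective on the kernel of `innerNum` in outer degree `< s`. -/
theorem exists_injective_on_ker_innerNum [CharZero K] (hG : G ≠ 0) (s : ℕ)
    (hγ : γ' = γ ∨ γ' + 1 = γ ∧ ∀ Y, innerNum G My r Y = 0 → Y = 0) :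
    ∃ k, k + γ * s ≤ γ' * s + s ∧ ∃ ρ : K[X][X] →ₗ[K] (Fin k → K),
      ∀ Y : K[X][X], (∀ i, s ≤ i → Y.coeff i = 0) → innerNum G My r Y = 0 → ρ Y = 0 → Y = 0 := by
  by_cases hinj : ∀ Y, innerNum G My r Y = 0 → Y = 0
  · refine ⟨0, ?_, 0, fun Y _ hY _ => hinj Y hY⟩
    rcases hγ with rfl | ⟨rfl, -⟩
    · omega
    · exact (by ring : 0 + (γ' + 1) * s = γ' * s + s).le
  · obtain rfl : γ' = γ := hγ.resolve_right fun h => hinj h.2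
    push Not at hinj
    obtain ⟨Z, hZ, hZ0⟩ := hinj
    refine ⟨s, by omega, LinearMap.pi fun i =>
      lcoeff K (Bivariate.swap Z).natDegree ∘ₗ (lcoeff K[X] (i : ℕ)).restrictScalars K, ?_⟩
    intro Y hYs hY hρ
    by_contra hY0
    have hdeg := natDegree_swap_eq_of_innerNum_eq_zero hG hY0 hZ0 hY hZ
    have hl := leadingCoeff_ne_zero.2 (swap_ne_zero hY0)
    apply hl
    rw [leadingCoeff, hdeg]
    ext i
    rw [coeff_coeff_swap, coeff_zero]
    by_cases hi : i < s
    · exact congrFun hρ ⟨i, hi⟩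
    · rw [hYs i (not_lt.1 hi), coeff_zero]

/-- Dimension count for telescopers taken from a space `V` of coefficient vectors. -/
theorem hasTelescoper_of_finrank [CharZero K] (hinj : Function.Injective ι)
    (hΔx : ∀ q, Δx (ι q) = ι (derivative q)) (hΔy : ∀ q, Δy (ι q) = ι (dY q))
    (hdata : LogData Δx Δy ι H G Mx My α γ) (hc0 : c0 ≠ 0)
    (hdy : (Bivariate.swap c0).natDegree ≤ dy)
    (hγ : γ' = γ ∨ γ' + 1 = γ ∧ ∀ Y, innerNum G My r Y = 0 → Y = 0)
    (hγr : γ ≤ dy + r * γ + 1)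
    {V : Type*} [AddCommGroup V] [Module K V] [FiniteDimensional K V]
    (pm : V →ₗ[K] (Fin (r + 1) → K[X])) (hpm : Function.Injective pm)
    (hdeg : ∀ v i, (pm v i).natDegree ≤ d) (B : ℕ)
    (hB : ∀ v j, B ≤ j → (∑ i : Fin (r + 1),
      liftX (pm v i) * (iterNum c0 G Mx i * G ^ (r - (i : ℕ)))).coeff j = 0)
    (hcard : γ' * (B - α) + α * (dy + r * γ + 1) < Module.finrank K V) :
    HasTelescoper Δx Δy ι (ι c0 * H) r d := by
  obtain ⟨k, hk, ρ, hρ⟩ := exists_injective_on_ker_innerNum (My := My) (r := r) hdata.ne_zero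
    (B - α) hγ
  let Φ : V →ₗ[K] K[X][X] := ∑ i : Fin (r + 1),
    LinearMap.mulRight K (iterNum c0 G Mx i * G ^ (r - (i : ℕ))) ∘ₗ liftXLinear ∘ₗ
      LinearMap.proj i ∘ₗ pm
  have hΦ : ∀ v, Φ v = ∑ i : Fin (r + 1),
      liftX (pm v i) * (iterNum c0 G Mx i * G ^ (r - (i : ℕ))) := by
    intro v
    simp [Φ, liftXLinear_apply, mul_assoc]
  have hΦy : ∀ v i j, dy + r * γ + 1 ≤ j → ((Φ v).coeff i).coeff j = 0 := by
    intro v i j hj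
    rw [hΦ]
    apply coeff_eq_zero_of_natDegree_lt
    refine lt_of_le_of_lt ((natDegree_swap_le_iff _ (dy + r * γ)).1 ?_ i) (by omega)
    rw [map_sum]
    refine natDegree_sum_le_of_forall_le _ _ fun i _ => ?_
    rw [map_mul, map_mul, map_pow]
    refine (natDegree_mul_le_of_le (natDegree_swap_liftX _).le (natDegree_mul_le_of_le
      (natDegree_swap_iterNum_le hdy hdata.degy_G hdata.degy_Mx i)
      (natDegree_pow_le_of_le (r - (i : ℕ)) hdata.degy_G))).trans ?_
    rw [zero_add, add_assoc, ← add_mul, Nat.add_sub_cancel' (Nat.lt_succ_iff.1 i.2)]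
  have hΛx : ∀ Y : K[X][X], (∀ i, B - α ≤ i → Y.coeff i = 0) →
      ∀ i, B ≤ i → (innerNum G My r Y).coeff i = 0 := by
    intro Y hY i hi
    by_cases hs : B - α = 0
    · have : Y = 0 := by
        ext1 j
        exact hY j (by omega)
      simp [this]
    · apply coeff_eq_zero_of_natDegree_lt
      have h1 := natDegree_innerNum_le hdata.degx_G hdata.degx_My r Y
      have h2 : Y.natDegree ≤ B - α - 1 :=
        natDegree_le_iff_coeff_eq_zero.2 fun N hN => hY N (by omega)
      omega
  have hΛy : ∀ Y : K[X][X], (∀ i j, dy + r * γ + 2 - γ ≤ j → (Y.coeff i).coeff j = 0) →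
      ∀ i j, dy + r * γ + 1 ≤ j → ((innerNum G My r Y).coeff i).coeff j = 0 := by
    intro Y hY i j hj
    have h2 : (Bivariate.swap Y).natDegree ≤ dy + r * γ + 2 - γ - 1 :=
      (natDegree_swap_le_iff _ _).2 fun i => natDegree_le_iff_coeff_eq_zero.2 fun N hN =>
        hY i N (by omega)
    rw [← coeff_coeff_swap, natDegree_add_one_le_of_X_mul
      (natDegree_X_mul_swap_innerNum_le hdata.degy_G hdata.degy_My r Y) (by omega), coeff_zero]
  have hlt : B * (dy + r * γ + 1) + k <
      Module.finrank K V + (B - α) * (dy + r * γ + 2 - γ) := by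
    obtain ⟨t, ht⟩ := Nat.exists_eq_add_of_le hγr
    have ht' : dy + r * γ + 2 - γ = t + 1 := by omega
    rw [ht']
    have h1 : B * (dy + r * γ + 1) ≤ (B - α + α) * (dy + r * γ + 1) :=
      Nat.mul_le_mul_right _ (by omega)
    generalize B - α = s at *
    have h2 : s * (dy + r * γ + 1) = s * (γ + t) := by rw [ht]
    nlinarith
  obtain ⟨v, hv, Y, hvY⟩ := exists_ne_zero_map_eq Φ (innerNum G My r) B (dy + r * γ + 1) (B - α)
    (dy + r * γ + 2 - γ) k (fun v j hj => by rw [hΦ]; exact hB v j hj) hΦy hΛx hΛy ρ hρ hlt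
  have hιG : ι G ≠ 0 := (map_ne_zero_iff ι hinj).2 hdata.ne_zero
  have hιc0 : ι c0 ≠ 0 := (map_ne_zero_iff ι hinj).2 hc0
  refine ⟨fun i => if hi : i < r + 1 then pm v ⟨i, hi⟩ else 0, ?_, ?_, Y * G, c0 * G ^ r,
    mul_ne_zero hc0 (pow_ne_zero _ hdata.ne_zero), ?_⟩
  · by_contra! hall
    refine hv (hpm (funext fun i => ?_))
    have := hall i (Nat.lt_succ_iff.1 i.2)
    simpa only [dif_pos i.2, Fin.eta, map_zero, Pi.zero_apply] using this
  · intro i hi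
    simpa [Nat.lt_succ_iff.2 hi] using hdeg v ⟨i, Nat.lt_succ_iff.2 hi⟩
  · have h1 : ι (Y * G) * (ι c0 * H) / ι (c0 * G ^ r) = ι (Y * G) * H / ι G ^ r := by
      rw [map_mul ι c0, map_pow]
      field_simp
    rw [h1]
    apply mul_right_cancel₀ (pow_ne_zero r hιG)
    rw [derivation_innerNum hinj hΔy hdata.ne_zero hdata.eqy, ← hvY, hΦ, map_sum,
      Finset.sum_range, Finset.sum_mul, Finset.sum_mul]
    refine Finset.sum_congr rfl fun i _ => ?_
    have h2 := iterate_mul_pow (c0 := c0) hinj hΔx hdata.ne_zero hdata.eqx (i : ℕ)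
    have h3 : ι G ^ r = ι G ^ (i : ℕ) * ι G ^ (r - (i : ℕ)) := by
      rw [← pow_add, Nat.add_sub_cancel' (Nat.lt_succ_iff.1 i.2)]
    simp only [i.2, dif_pos, Fin.eta, map_mul, map_pow, h3]
    linear_combination ι (liftX (pm v i)) * ι G ^ (r - (i : ℕ)) * h2

/-- The outer degree and the leading coefficient of the numerators over the common denominator
`G ^ r`. -/
theorem natDegree_X_pow_mul_iterNum_mul_pow (hdata : LogData Δx Δy ι H G Mx My α γ)
    (hdx : c0.natDegree ≤ dx) :
    ∃ (g : K[X]) (κ : ℕ → K), ∀ i ≤ r,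
      (X ^ i * (iterNum c0 G Mx i * G ^ (r - i))).natDegree ≤ dx + r * α ∧
      (X ^ i * (iterNum c0 G Mx i * G ^ (r - i))).coeff (dx + r * α) = κ i • g := by
  obtain ⟨lam, hlam⟩ := hdata.lead
  have h := natDegree_X_pow_mul_iterNum hdx hdata.degx_G hdata.degx_Mx hlam
  choose h1 κ h2 using h
  refine ⟨c0.coeff dx * G.coeff α ^ r, κ, fun i hi => ?_⟩
  have h3 := natDegree_pow_le_of_le (r - i) hdata.degx_G
  have h4 : dx + r * α = dx + i * α + (r - i) * α := by
    rw [add_assoc, ← add_mul, Nat.add_sub_cancel' hi]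
  rw [← mul_assoc, h4]
  refine ⟨natDegree_mul_le_of_le (h1 i) h3, ?_⟩
  rw [coeff_mul_add_eq_of_natDegree_le (h1 i) h3, h2, coeff_pow_of_natDegree_le hdata.degx_G,
    smul_mul_assoc, mul_assoc, ← pow_add, Nat.add_sub_cancel' hi]

theorem finrank_pi_degreeLT (n : ℕ) (m : Fin n → ℕ) :
    Module.finrank K ((i : Fin n) → degreeLT K (m i)) = ∑ i, m i := by
  have : ∀ i, Module.finrank K (degreeLT K (m i)) = m i := fun i => by
    rw [(degreeLTEquiv K (m i)).finrank_eq, Module.finrank_fin_fun]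
  have hf : ∀ i, Module.Finite K (degreeLT K (m i)) := fun i =>
    Module.Finite.equiv (degreeLTEquiv K (m i)).symm
  rw [Module.finrank_pi_fintype]
  exact Finset.sum_congr rfl fun i _ => this i

theorem natDegree_le_of_mem_degreeLT {m d : ℕ} (p : degreeLT K m) (hm : m ≤ d + 1) :
    (p : K[X]).natDegree ≤ d := by
  have h : ∀ k, m ≤ k → (p : K[X]).coeff k = 0 := fun k hk =>
    coeff_eq_zero_of_degree_lt ((mem_degreeLT.1 p.2).trans_le (by exact_mod_cast hk))
  exact natDegree_le_iff_coeff_eq_zero.2 fun k hk => h k (by omega)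

end Telescoper

section Shape

variable {K : Type*} [Field K]

theorem coeff_liftX_mul_eq_zero {p : K[X]} {P : K[X][X]} {i j u D : ℕ} (hp : p.natDegree ≤ u)
    (hP : (X ^ i * P).natDegree ≤ D) (hj : u + D < j + i) : (liftX p * P).coeff j = 0 := by
  rw [← coeff_X_pow_mul (liftX p * P) i j, mul_left_comm]
  exact coeff_eq_zero_of_natDegree_lt
    ((natDegree_mul_le_of_le ((natDegree_liftX_le p).trans hp) hP).trans_lt hj)

theorem coeff_liftX_mul_eq {p : K[X]} {P : K[X][X]} {i j u D : ℕ} (hp : p.natDegree ≤ u)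
    (hP : (X ^ i * P).natDegree ≤ D) (hj : j + i = u + D) :
    (liftX p * P).coeff j = p.coeff u • (X ^ i * P).coeff D := by
  rw [← coeff_X_pow_mul (liftX p * P) i j, mul_left_comm, hj,
    coeff_mul_add_eq_of_natDegree_le ((natDegree_liftX_le p).trans hp) hP, coeff_liftX,
    smul_eq_C_mul]

/-- Coefficient vectors whose `i`-th entry has degree less than `m i`. -/
noncomputable def shapeMap {n : ℕ} (m : Fin n → ℕ) :
    ((i : Fin n) → degreeLT K (m i)) →ₗ[K] (Fin n → K[X]) :=
  LinearMap.pi fun i => (degreeLT K (m i)).subtype ∘ₗ LinearMap.proj i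

theorem shapeMap_apply {n : ℕ} (m : Fin n → ℕ) (v : (i : Fin n) → degreeLT K (m i)) (i : Fin n) :
    shapeMap m v i = (v i : K[X]) := rfl

theorem shapeMap_injective {n : ℕ} (m : Fin n → ℕ) :
    Function.Injective (shapeMap (K := K) m) := fun _ _ h =>
  funext fun i => Subtype.ext (congrFun h i)

theorem finite_degreeLT (m : ℕ) : Module.Finite K (degreeLT K m) :=
  Module.Finite.equiv (degreeLTEquiv K m).symm

theorem two_mul_sum_range_sub (w n : ℕ) :
    2 * ∑ i ∈ Finset.range n, (w - i) + (w - n) * (w - n + 1) = w * (w + 1) := by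
  induction n with
  | zero => simp
  | succ n ih =>
    rw [Finset.sum_range_succ, ← ih]
    rcases Nat.lt_or_ge n w with h | h
    · obtain ⟨k, rfl⟩ := Nat.exists_eq_add_of_lt h
      rw [show n + k + 1 - n = k + 1 by omega, show n + k + 1 - (n + 1) = k by omega]
      ring
    · rw [show w - n = 0 by omega, show w - (n + 1) = 0 by omega]
      ring

variable {E : Type*} [Field E] {Δx Δy : Derivation ℤ E E} {ι : K[X][X] →+* E} {H : E}
  {c0 G Mx My : K[X][X]} {α γ γ' dx dy r d w : ℕ}

/-- A telescoper exists if the number of coefficients of the rectangular ansatz is large. -/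
theorem hasTelescoper_of_rectangle [CharZero K] (hinj : Function.Injective ι)
    (hΔx : ∀ q, Δx (ι q) = ι (derivative q)) (hΔy : ∀ q, Δy (ι q) = ι (dY q))
    (hdata : LogData Δx Δy ι H G Mx My α γ) (hc0 : c0 ≠ 0) (hdx : c0.natDegree ≤ dx)
    (hdy : (Bivariate.swap c0).natDegree ≤ dy)
    (hγ : γ' = γ ∨ γ' + 1 = γ ∧ ∀ Y, innerNum G My r Y = 0 → Y = 0)
    (hγr : γ ≤ dy + r * γ + 1)
    (hcard : γ' * (dx + r * α + d + 1 - α) + α * (dy + r * γ + 1) < (r + 1) * (d + 1)) :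
    HasTelescoper Δx Δy ι (ι c0 * H) r d := by
  obtain ⟨g, κ, hκ⟩ := natDegree_X_pow_mul_iterNum_mul_pow (r := r) hdata hdx
  let m : Fin (r + 1) → ℕ := fun _ => d + 1
  have hfin : ∀ i, Module.Finite K (degreeLT K (m i)) := fun i => finite_degreeLT _
  refine hasTelescoper_of_finrank hinj hΔx hΔy hdata hc0 hdy hγ hγr (shapeMap m)
    (shapeMap_injective m) (fun v i => natDegree_le_of_mem_degreeLT _ le_rfl) _ ?_
    (hcard.trans_le ?_)
  · intro v j hj
    rw [finsetSum_coeff]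
    refine Finset.sum_eq_zero fun i _ => coeff_liftX_mul_eq_zero
      (natDegree_le_of_mem_degreeLT (v i) le_rfl) (hκ i (Nat.lt_succ_iff.1 i.2)).1 (by omega)
  · rw [finrank_pi_degreeLT]
    simp [m]

/-- Dimension count for telescopers taken from a hyperplane of a space of coefficient vectors. -/
theorem hasTelescoper_of_finrank_ker [CharZero K] (hinj : Function.Injective ι)
    (hΔx : ∀ q, Δx (ι q) = ι (derivative q)) (hΔy : ∀ q, Δy (ι q) = ι (dY q))
    (hdata : LogData Δx Δy ι H G Mx My α γ) (hc0 : c0 ≠ 0)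
    (hdy : (Bivariate.swap c0).natDegree ≤ dy)
    (hγ : γ' = γ ∨ γ' + 1 = γ ∧ ∀ Y, innerNum G My r Y = 0 → Y = 0)
    (hγr : γ ≤ dy + r * γ + 1)
    {V : Type*} [AddCommGroup V] [Module K V] [FiniteDimensional K V]
    (pm : V →ₗ[K] (Fin (r + 1) → K[X])) (hpm : Function.Injective pm)
    (hdeg : ∀ v i, (pm v i).natDegree ≤ d) (τ : V →ₗ[K] K) (B : ℕ)
    (hB : ∀ v, τ v = 0 → ∀ j, B ≤ j → (∑ i : Fin (r + 1),
      liftX (pm v i) * (iterNum c0 G Mx i * G ^ (r - (i : ℕ)))).coeff j = 0)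
    (hcard : γ' * (B - α) + α * (dy + r * γ + 1) + 1 < Module.finrank K V) :
    HasTelescoper Δx Δy ι (ι c0 * H) r d := by
  have h1 := LinearMap.finrank_range_add_finrank_ker τ
  have h2 : Module.finrank K (LinearMap.range τ) ≤ 1 :=
    (Submodule.finrank_le _).trans (Module.finrank_self K).le
  exact hasTelescoper_of_finrank hinj hΔx hΔy hdata hc0 hdy hγ hγr
    (pm ∘ₗ (LinearMap.ker τ).subtype) (hpm.comp Subtype.val_injective) (fun v i => hdeg _ i) B
    (fun v => hB v v.2) (by omega)

/-- A telescoper exists if the number of coefficients of the ansatz without its lower corner and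
with one relation among its leading coefficients is large. -/
theorem hasTelescoper_of_trapezoid [CharZero K] (hinj : Function.Injective ι)
    (hΔx : ∀ q, Δx (ι q) = ι (derivative q)) (hΔy : ∀ q, Δy (ι q) = ι (dY q))
    (hdata : LogData Δx Δy ι H G Mx My α γ) (hc0 : c0 ≠ 0) (hdx : c0.natDegree ≤ dx)
    (hdy : (Bivariate.swap c0).natDegree ≤ dy)
    (hγ : γ' = γ ∨ γ' + 1 = γ ∧ ∀ Y, innerNum G My r Y = 0 → Y = 0)
    (hγr : γ ≤ dy + r * γ + 1) (hwd : w ≤ d)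
    (hcard : 2 * (γ' * (dx + r * α + d - w - α) + α * (dy + r * γ + 1) + 1) + w * (w + 1) <
      2 * ((r + 1) * (d + 1))) :
    HasTelescoper Δx Δy ι (ι c0 * H) r d := by
  obtain ⟨g, κ, hκ⟩ := natDegree_X_pow_mul_iterNum_mul_pow (r := r) hdata hdx
  let m : Fin (r + 1) → ℕ := fun i => d + 1 - (w - (i : ℕ))
  have hfin : ∀ i, Module.Finite K (degreeLT K (m i)) := fun i => finite_degreeLT _
  have hv : ∀ (v : (i : Fin (r + 1)) → degreeLT K (m i)) i,
      (v i : K[X]).natDegree ≤ d - (w - (i : ℕ)) := fun v i =>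
    natDegree_le_of_mem_degreeLT _ (by simp only [m]; omega)
  let τ : ((i : Fin (r + 1)) → degreeLT K (m i)) →ₗ[K] K :=
    ∑ i : Fin (r + 1), (if (i : ℕ) ≤ w then κ i else 0) •
      (lcoeff K (d - (w - (i : ℕ))) ∘ₗ LinearMap.proj i ∘ₗ shapeMap m)
  refine hasTelescoper_of_finrank_ker hinj hΔx hΔy hdata hc0 hdy hγ hγr (shapeMap m)
    (shapeMap_injective m) (fun v i => (hv v i).trans (Nat.sub_le _ _)) τ
    (dx + r * α + d - w) ?_ ?_
  · intro v hτ j hj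
    rw [finsetSum_coeff]
    rcases hj.lt_or_eq with hj | rfl
    · refine Finset.sum_eq_zero fun i _ => coeff_liftX_mul_eq_zero (hv v i)
        (hκ i (Nat.lt_succ_iff.1 i.2)).1 (by omega)
    · have hs : τ v • g = 0 := by rw [hτ, zero_smul]
      rw [← hs]
      simp only [τ, LinearMap.sum_apply, Finset.sum_smul]
      refine Finset.sum_congr rfl fun i _ => ?_
      have hi := hκ i (Nat.lt_succ_iff.1 i.2)
      by_cases hiw : (i : ℕ) ≤ w
      · refine (coeff_liftX_mul_eq (hv v i) hi.1 (by omega)).trans ?_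
        rw [hi.2, smul_smul]
        simp [hiw, shapeMap_apply, mul_comm]
      · refine (coeff_liftX_mul_eq_zero (hv v i) hi.1 (by omega)).trans ?_
        simp [hiw]
  · rw [finrank_pi_degreeLT]
    have h3 : ∑ i, m i + ∑ i ∈ Finset.range (r + 1), (w - i) = (r + 1) * (d + 1) := by
      rw [Finset.sum_range, ← Finset.sum_add_distrib, Finset.sum_congr rfl
        (g := fun _ => d + 1) fun i _ => by simp only [m]; omega]
      simp
    have h4 := two_mul_sum_range_sub w (r + 1)
    omega

end Shape

section Kernel

variable {K : Type*} [Field K]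

theorem pow_dvd_mul_derivation {A : Type*} [CommRing A] [Algebra K A] (D : Derivation K A A)
    {q x : A} {t : ℕ} (h : q ^ t ∣ x) : q ^ t ∣ q * D x := by
  obtain ⟨y, rfl⟩ := h
  rw [D.leibniz, D.leibniz_pow]
  rcases t with _ | t
  · simp
  · simp only [Nat.add_sub_cancel, smul_eq_mul, nsmul_eq_mul]
    exact ⟨q * D y + ((t + 1 : ℕ) : A) * y * D q, by ring⟩

theorem Prime.exists_eq_pow_mul_and_not_dvd {q p : K[X][X]} (hq : Prime q) (hp : p ≠ 0) :
    ∃ k p', ¬ q ∣ p' ∧ p = q ^ k * p' := by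
  obtain ⟨k, p', h, h'⟩ := WfDvdMonoid.max_power_factor hp hq.irreducible
  exact ⟨k, p', h, h'⟩

variable {L : ℕ} {B a b s : K[X][X]} {c : Fin L → K[X][X]} {e : Fin L → K}

theorem pow_dvd_mul_logSum (D : Derivation K K[X][X] K[X][X]) {q : K[X][X]} (hq : Prime q)
    (hc : ∀ ℓ, c ℓ ≠ 0) {t : ℕ} (h : q ^ t ∣ ∏ ℓ, c ℓ) :
    q ^ t ∣ q * ∑ ℓ, e ℓ • (D (c ℓ) * ∏ j ∈ Finset.univ.erase ℓ, c j) := by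
  rw [Finset.mul_sum]
  refine Finset.dvd_sum fun ℓ _ => ?_
  rw [mul_smul_comm, ← mul_assoc]
  apply dvd_smul_of_dvd
  obtain ⟨k, c', hc', hk⟩ := hq.exists_eq_pow_mul_and_not_dvd (hc ℓ)
  have h1 : q ^ k ∣ q * D (c ℓ) := pow_dvd_mul_derivation D ⟨c', hk⟩
  rcases le_total t k with htk | htk
  · exact ((pow_dvd_pow q htk).trans h1).mul_right _
  · obtain ⟨u, rfl⟩ := Nat.exists_eq_add_of_le htk
    rw [pow_add]
    refine mul_dvd_mul h1 ?_
    rw [← Finset.mul_prod_erase _ _ (Finset.mem_univ ℓ), hk, pow_add, mul_assoc,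
      mul_dvd_mul_iff_left (pow_ne_zero _ hq.ne_zero)] at h
    exact hq.pow_dvd_of_dvd_mul_left u hc' h

/-- The order of a prime factor in the coefficients of `innerNum` with nontrivial kernel. -/
theorem pow_dvd_mul_of_innerNum_eq_zero {G M Y q : K[X][X]} {r t : ℕ} (hq : Prime q) (hY0 : Y ≠ 0)
    (hY : innerNum G M r Y = 0) (h : q ^ t ∣ G) : q ^ t ∣ q * M := by
  obtain ⟨k, Y', hY', rfl⟩ := hq.exists_eq_pow_mul_and_not_dvd hY0
  obtain ⟨u, hu⟩ := pow_dvd_mul_derivation dY (Dvd.intro Y' rfl : q ^ k ∣ q ^ k * Y')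
  obtain ⟨v, hv⟩ := pow_dvd_mul_derivation dY h
  obtain ⟨g, rfl⟩ := h
  rw [innerNum_apply] at hY
  refine hq.pow_dvd_of_dvd_mul_right t hY' ⟨-(g * u + (1 - (r : K[X][X])) * v * Y'), ?_⟩
  apply mul_left_cancel₀ (pow_ne_zero k hq.ne_zero)
  linear_combination q * hY - q ^ t * g * hu - (1 - (r : K[X][X])) * q ^ k * Y' * hv

theorem not_dvd_of_mul_eq [CharZero K] {q : K[X][X]} (hq : Prime q)
    (hqy : 0 < (Bivariate.swap q).natDegree) (hb : b ≠ 0) (hqb : q ∣ b) (hqs : q ∣ s)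
    (hs : Squarefree s) (hB : b * B = s * dY b) : ¬ q ∣ B := by
  intro hqB
  obtain ⟨m, b', hb', rfl⟩ := hq.exists_eq_pow_mul_and_not_dvd hb
  obtain ⟨s', rfl⟩ := hqs
  have hs' : ¬ q ∣ s' := fun ⟨u, hu⟩ =>
    hq.not_isUnit (hs q ⟨u, by rw [hu]; ring⟩)
  rcases m with _ | m
  · simp only [pow_zero, one_mul] at hqb
    exact hb' hqb
  · obtain ⟨u, rfl⟩ := hqB
    rw [dY.leibniz, dY.leibniz_pow] at hB
    simp only [Nat.add_sub_cancel, smul_eq_mul, nsmul_eq_mul] at hB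
    have h : q ∣ s' * (((m + 1 : ℕ) : K[X][X]) * (dY q * b')) := by
      refine ⟨b' * u - s' * dY b', ?_⟩
      apply mul_left_cancel₀ (pow_ne_zero (m + 1) hq.ne_zero)
      linear_combination -hB
    have hm : ¬ q ∣ ((m + 1 : ℕ) : K[X][X]) := by
      intro hdvd
      apply hq.not_isUnit
      refine isUnit_of_dvd_unit hdvd ?_
      rw [← map_natCast (algebraMap K K[X][X])]
      exact (Ne.isUnit (by exact_mod_cast Nat.succ_ne_zero m)).map _
    rcases hq.dvd_or_dvd h with h | h
    · exact hs' h
    rcases hq.dvd_or_dvd h with h | h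
    · exact hm h
    rcases hq.dvd_or_dvd h with h | h
    · exact not_dvd_dY hqy h
    · exact hb' h

/-- A prime factor of the denominator of the exponent divides its numerator as soon as `innerNum`
has a nontrivial kernel. -/
theorem dvd_of_innerNum_eq_zero [CharZero K] {q Y : K[X][X]} {r : ℕ} (hq : Prime q)
    (hqy : 0 < (Bivariate.swap q).natDegree) (hb : b ≠ 0) (hqb : q ∣ b) (hqs : q ∣ s)
    (hs : Squarefree s) (hc : ∀ ℓ, c ℓ ≠ 0) (hB : b * B = s * dY b) (hY0 : Y ≠ 0)
    (hY : innerNum (b * s * ∏ ℓ, c ℓ) (logNum dY B a b s c e) r Y = 0) : q ∣ a := by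
  have hqB := not_dvd_of_mul_eq hq hqy hb hqb hqs hs hB
  have hP0 : ∏ ℓ, c ℓ ≠ 0 := Finset.prod_ne_zero_iff.2 fun ℓ _ => hc ℓ
  obtain ⟨t, P', hP', hP⟩ := hq.exists_eq_pow_mul_and_not_dvd hP0
  have h1 : q ^ (t + 2) ∣ q * logNum dY B a b s c e := by
    refine pow_dvd_mul_of_innerNum_eq_zero hq hY0 hY ?_
    rw [hP, pow_add, mul_comm]
    exact mul_dvd_mul (pow_two q ▸ mul_dvd_mul hqb hqs) (Dvd.intro _ rfl)
  have h2 : q ^ t ∣ q * ∑ ℓ, e ℓ • (dY (c ℓ) * ∏ j ∈ Finset.univ.erase ℓ, c j) :=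
    pow_dvd_mul_logSum dY hq hc ⟨P', hP⟩
  rw [logNum, hP] at h1
  obtain ⟨b', rfl⟩ := hqb
  obtain ⟨s', rfl⟩ := hqs
  obtain ⟨u, hu⟩ := h1
  obtain ⟨v, hv⟩ := h2
  have h3 : q ∣ a * B * P' := by
    refine ⟨dY a * s' * P' + b' * s' * v - u, ?_⟩
    apply mul_left_cancel₀ (pow_ne_zero (t + 1) hq.ne_zero)
    linear_combination -hu + q * q * b' * s' * hv
  rcases hq.dvd_or_dvd h3 with h | h
  · exact (hq.dvd_or_dvd h).resolve_right hqB
  · exact absurd h hP'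

theorem dvd_logNum_of_dvd (D : K[X][X] → K[X][X]) {q : K[X][X]} (hqa : q ∣ a) (hqs : q ∣ s) :
    q ∣ logNum D B a b s c e :=
  dvd_add ((dvd_sub (hqs.mul_left _) (hqa.mul_right _)).mul_right _)
    ((hqs.mul_left _).mul_right _)

theorem dvd_logNum_of_sq_dvd (D : Derivation K K[X][X] K[X][X]) {q : K[X][X]} (hq : Prime q)
    (hc : ∀ ℓ, c ℓ ≠ 0) (h : q ^ 2 ∣ ∏ ℓ, c ℓ) : q ∣ logNum D B a b s c e := by
  refine dvd_add (((dvd_pow_self q two_ne_zero).trans h).mul_left _) (Dvd.dvd.mul_left ?_ _)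
  have := pow_dvd_mul_logSum (e := e) D hq hc h
  rwa [pow_two, mul_dvd_mul_iff_left hq.ne_zero] at this

theorem exists_logNum_eq (D : Derivation K K[X][X] K[X][X]) {q c' : K[X][X]} {ℓ : Fin L}
    (hℓ : c ℓ = q * c') : ∃ M, logNum D B a b s c e =
      e ℓ • (D q * (b * s * (c' * ∏ j ∈ Finset.univ.erase ℓ, c j))) + q * M := by
  have h1 : ∑ i ∈ Finset.univ.erase ℓ, e i • (D (c i) * ∏ j ∈ Finset.univ.erase i, c j) ∈
      Ideal.span {q} := by
    refine Ideal.sum_mem _ fun i hi => Ideal.mem_span_singleton.2 ?_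
    apply dvd_smul_of_dvd
    refine Dvd.dvd.mul_left ((Dvd.intro c' hℓ.symm).trans (Finset.dvd_prod_of_mem c ?_)) _
    exact Finset.mem_erase.2 ⟨(Finset.ne_of_mem_erase hi).symm, Finset.mem_univ _⟩
  obtain ⟨u, hu⟩ := Ideal.mem_span_singleton.1 h1
  refine ⟨(D a * s - a * B) * (c' * ∏ j ∈ Finset.univ.erase ℓ, c j) +
    b * s * (e ℓ • (D c' * ∏ j ∈ Finset.univ.erase ℓ, c j) + u), ?_⟩
  rw [logNum, ← Finset.mul_prod_erase _ _ (Finset.mem_univ ℓ),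
    ← Finset.add_sum_erase _ _ (Finset.mem_univ ℓ), hu, hℓ, D.leibniz]
  simp only [smul_eq_mul, Algebra.smul_def]
  ring

/-- The exponent of a simple factor is an integer less than `r` as soon as `innerNum` has a
nontrivial kernel. -/
theorem exponent_eq_of_innerNum_eq_zero [CharZero K] {q G M Y : K[X][X]} {r : ℕ} {ε : K}
    (hq : Prime q) (hqy : 0 < (Bivariate.swap q).natDegree) (hG : ¬ q ∣ G) (hY0 : Y ≠ 0)
    (hY : innerNum (q * G) (ε • (dY q * G) + q * M) r Y = 0) : ∃ k : ℕ, ε + k + 1 = r := by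
  obtain ⟨k, Y', hY', rfl⟩ := hq.exists_eq_pow_mul_and_not_dvd hY0
  refine ⟨k, ?_⟩
  have hk : q * ((k : K[X][X]) * q ^ (k - 1)) = k * q ^ k := by
    cases k with
    | zero => simp
    | succ k => rw [Nat.add_sub_cancel, pow_succ]; ring
  rw [innerNum_apply, dY.leibniz, dY.leibniz_pow, dY.leibniz] at hY
  simp only [smul_eq_mul, nsmul_eq_mul, Algebra.smul_def (R := K)] at hY
  have h : q ∣ algebraMap K K[X][X] (ε + k + 1 - r) * (dY q * (G * Y')) := by
    simp only [map_add, map_sub, map_one, map_natCast]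
    refine ⟨-(G * dY Y' + ((1 - (r : K[X][X])) * dY G + M) * Y'), ?_⟩
    apply mul_left_cancel₀ (pow_ne_zero k hq.ne_zero)
    linear_combination hY - G * Y' * dY q * hk
  rcases hq.dvd_or_dvd h with h | h
  · by_contra hne
    apply hq.not_isUnit
    refine isUnit_of_dvd_unit h ((Ne.isUnit ?_).map _)
    rwa [Ne, sub_eq_zero]
  · rcases hq.dvd_or_dvd h with h | h
    · exact absurd h (not_dvd_dY hqy)
    · exact absurd h fun h => (hq.dvd_or_dvd h).elim hG hY'

end Kernel

section Reduction

variable {K : Type*} [Field K]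

theorem natDegree_le_sub_of_mul {q p : K[X][X]} {n : ℕ} (hq : q ≠ 0)
    (h : (q * p).natDegree ≤ n) : p.natDegree ≤ n - q.natDegree := by
  by_cases hp : p = 0
  · simp [hp]
  · rw [natDegree_mul hq hp] at h
    omega

/-- Removing the factor `q ^ n` from `H`. -/
theorem LogData.reduce {E : Type*} [Field E] {Δx Δy : Derivation ℤ E E} {ι : K[X][X] →+* E}
    {H : E} {q G Mx My : K[X][X]} {α γ n : ℕ} (hinj : Function.Injective ι)
    (hΔx : ∀ q, Δx (ι q) = ι (derivative q)) (hΔy : ∀ q, Δy (ι q) = ι (dY q)) (hq : q ≠ 0)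
    (hdata : LogData Δx Δy ι H (q * G) (n * (derivative q * G) + q * Mx)
      (n * (dY q * G) + q * My) α γ) :
    LogData Δx Δy ι (H / ι q ^ n) G Mx My (α - q.natDegree)
      (γ - (Bivariate.swap q).natDegree) := by
  obtain ⟨hG0, eqx, eqy, dxG, dxMx, dxMy, dyG, dyMx, dyMy, lam, hlam⟩ := hdata
  have hιq : ι q ≠ 0 := (map_ne_zero_iff ι hinj).2 hq
  have hsq : Bivariate.swap q ≠ 0 := swap_ne_zero hq
  have hG : G ≠ 0 := right_ne_zero_of_mul hG0
  have hn : (n : E) * ι q ^ (n - 1) * ι q = n * ι q ^ n := by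
    cases n with
    | zero => simp
    | succ n => rw [Nat.add_sub_cancel, pow_succ]; ring
  have hle : q.natDegree ≤ α := by
    rw [natDegree_mul hq hG] at dxG
    omega
  have hley : (Bivariate.swap q).natDegree ≤ γ := by
    rw [natDegree_swap_mul hq hG] at dyG
    omega
  have dxG' := natDegree_le_sub_of_mul hq dxG
  have dyG' : (Bivariate.swap G).natDegree ≤ γ - (Bivariate.swap q).natDegree :=
    natDegree_le_sub_of_mul hsq (by rwa [← map_mul])
  have hnat : ∀ {p : K[X][X]} {k : ℕ}, p.natDegree ≤ k → ((n : K[X][X]) * p).natDegree ≤ k :=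
    fun h => by simpa using natDegree_mul_le_of_le (natDegree_natCast n).le h
  have hX : q * (X * Mx) =
      X * ((n : K[X][X]) * (derivative q * G) + q * Mx) -
        (n : K[X][X]) * (X * derivative q * G) := by ring
  have dX' : (X * derivative q * G).natDegree ≤ α :=
    (natDegree_mul_le_of_le (natDegree_X_mul_derivative_le q) dxG').trans (by omega)
  have dxMx' : (X * Mx).natDegree ≤ α - q.natDegree := by
    apply natDegree_le_sub_of_mul hq
    rw [hX]
    exact (natDegree_sub_le _ _).trans (max_le dxMx (hnat dX'))
  refine ⟨hG, ?_, ?_, dxG', dxMx', ?_, dyG', ?_, ?_, ?_⟩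
  · rw [Derivation.leibniz_div, Derivation.leibniz_pow, hΔx]
    simp only [map_mul, map_add, map_natCast, smul_eq_mul, nsmul_eq_mul] at eqx ⊢
    field_simp
    apply mul_left_cancel₀ hιq
    linear_combination ι q ^ n * eqx - H * ι (derivative q) * ι G * hn
  · rw [Derivation.leibniz_div, Derivation.leibniz_pow, hΔy]
    simp only [map_mul, map_add, map_natCast, smul_eq_mul, nsmul_eq_mul] at eqy ⊢
    field_simp
    apply mul_left_cancel₀ hιq
    linear_combination ι q ^ n * eqy - H * ι (dY q) * ι G * hn
  · apply natDegree_le_sub_of_mul hq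
    rw [show q * My = n * (dY q * G) + q * My - n * (dY q * G) by ring]
    refine (natDegree_sub_le _ _).trans (max_le dxMy (hnat ?_))
    exact (natDegree_mul_le_of_le (natDegree_dY_le q) dxG').trans (by omega)
  · apply natDegree_le_sub_of_mul hsq
    rw [← map_mul, show q * Mx = n * (derivative q * G) + q * Mx - n * (derivative q * G) by ring,
      map_sub]
    refine (natDegree_sub_le _ _).trans (max_le dyMx ?_)
    rw [map_mul, map_natCast, map_mul]
    refine hnat ?_
    exact (natDegree_mul_le_of_le (natDegree_swap_derivative_le q) dyG').trans (by omega)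
  · apply natDegree_le_sub_of_mul hsq
    have h : Bivariate.swap q * (X * Bivariate.swap My) =
        X * Bivariate.swap ((n : K[X][X]) * (dY q * G) + q * My) -
          (n : K[X][X]) * (X * derivative (Bivariate.swap q) * Bivariate.swap G) := by
      simp only [map_add, map_mul, map_natCast, swap_dY]
      ring
    rw [h]
    refine (natDegree_sub_le _ _).trans (max_le dyMy (hnat ?_))
    exact (natDegree_mul_le_of_le (natDegree_X_mul_derivative_le _) dyG').trans (by omega)
  · refine ⟨lam - n * q.natDegree, ?_⟩
    obtain ⟨α', rfl⟩ := Nat.exists_eq_add_of_le hle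
    rw [Nat.add_sub_cancel_left] at dxG' dxMx' ⊢
    have h := congrArg (coeff · (q.natDegree + α')) hX
    beta_reduce at h
    rw [coeff_sub, hlam, coeff_mul_add_eq_of_natDegree_le le_rfl dxMx',
      coeff_mul_add_eq_of_natDegree_le le_rfl dxG', ← C_eq_natCast, coeff_C_mul,
      coeff_mul_add_eq_of_natDegree_le (natDegree_X_mul_derivative_le q) dxG',
      coeff_X_mul_derivative] at h
    have hlq : q.coeff q.natDegree ≠ 0 := by simpa using hq
    apply mul_left_cancel₀ hlq
    simp only [Algebra.smul_def, map_sub, map_mul, map_natCast] at h ⊢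
    linear_combination h

variable {L : ℕ} {Bx By a b s : K[X][X]} {c : Fin L → K[X][X]} {e : Fin L → K}

/-- The differential equations of `h / c₀` for `h` in standard form. -/
theorem logData_logNum {E : Type*} [Field E] {Δx Δy : Derivation ℤ E E} {ι : K[X][X] →+* E} {H : E}
    (hb : b ≠ 0) (hs : s ≠ 0) (hc : ∀ ℓ, c ℓ ≠ 0) (hBx : b * Bx = s * derivative b)
    (hBy : b * By = s * dY b) (hab : a.natDegree ≤ b.natDegree)
    (eqx : Δx H * ι (b * s * ∏ ℓ, c ℓ) = H * ι (logNum derivative Bx a b s c e))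
    (eqy : Δy H * ι (b * s * ∏ ℓ, c ℓ) = H * ι (logNum dY By a b s c e)) :
    LogData Δx Δy ι H (b * s * ∏ ℓ, c ℓ) (logNum derivative Bx a b s c e)
      (logNum dY By a b s c e) (s.natDegree + b.natDegree + ∑ ℓ, (c ℓ).natDegree)
      ((Bivariate.swap s).natDegree +
        max (Bivariate.swap a).natDegree (Bivariate.swap b).natDegree +
        ∑ ℓ, (Bivariate.swap (c ℓ)).natDegree) := by
  have hBx' : b * (X * Bx) = s * (X * derivative b) := by linear_combination X * hBx
  have hsBx : Bivariate.swap b * Bivariate.swap Bx =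
      Bivariate.swap s * Bivariate.swap (derivative (Bivariate.swap (Bivariate.swap b))) := by
    rw [Bivariate.swap_swap_apply, ← map_mul, hBx, map_mul]
  have hsBy : Bivariate.swap b * (X * Bivariate.swap By) =
      Bivariate.swap s * (X * derivative (Bivariate.swap b)) := by
    rw [← swap_dY, mul_left_comm, ← map_mul, hBy, map_mul]
    ring
  have hsb := swap_ne_zero hb
  refine ⟨mul_ne_zero (mul_ne_zero hb hs) (Finset.prod_ne_zero_iff.2 fun ℓ _ => hc ℓ), eqx, eqy,
    ?_, ?_, ?_, ?_, ?_, ?_, _, coeff_X_mul_logNum hb hBx hab⟩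
  · rw [add_comm s.natDegree]
    exact natDegree_mul_le_of_le natDegree_mul_le (natDegree_prod_le _ _)
  · rw [← logNum_mul_left]
    refine (natDegree_logNum_le natDegree_X_mul_derivative_le hb hBx').trans ?_
    rw [max_eq_right hab]
  · refine (natDegree_logNum_le natDegree_dY_le hb hBy).trans ?_
    rw [max_eq_right hab]
  · rw [map_mul, map_mul, map_prod]
    exact natDegree_mul_le_of_le (natDegree_mul_le.trans (by omega)) (natDegree_prod_le _ _)
  · rw [swap_logNum]
    exact natDegree_logNum_le (D := fun p => Bivariate.swap (derivative (Bivariate.swap p)))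
      natDegree_dY_le hsb hsBx
  · rw [swap_logNum, ← logNum_mul_left]
    simp only [swap_dY, Bivariate.swap_swap_apply]
    exact natDegree_logNum_le natDegree_X_mul_derivative_le hsb hsBy

theorem natDegree_swap_eq_zero_of_dY_mul_eq [CharZero K] {a b P S Y : K[X][X]} {r : ℕ}
    (hb : (Bivariate.swap b).natDegree = 0) (hP : P ≠ 0) (hY : Y ≠ 0)
    (hS : (X * Bivariate.swap S).natDegree ≤ (Bivariate.swap P).natDegree)
    (h : dY a * (P * Y) = b * (-(P * dY Y) - ((1 - (r : K[X][X])) * dY P + S) * Y)) :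
    (Bivariate.swap a).natDegree = 0 := by
  by_contra hay
  obtain ⟨ha0, had⟩ := natDegree_X_mul_derivative _ (Nat.pos_of_ne_zero hay)
  have h1 : (X * Bivariate.swap (dY a * (P * Y))).natDegree =
      (Bivariate.swap a).natDegree +
        ((Bivariate.swap P).natDegree + (Bivariate.swap Y).natDegree) := by
    rw [map_mul, swap_dY, ← mul_assoc, natDegree_mul ha0 (swap_ne_zero (mul_ne_zero hP hY)),
      had, natDegree_swap_mul hP hY]
  have hr : (1 - (r : K[X][X])).natDegree ≤ 0 := by
    have : (1 - (r : K[X][X])) = ((1 - (r : ℤ) : ℤ) : K[X][X]) := by push_cast; ring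
    rw [this, natDegree_intCast]
  have h2 : X * Bivariate.swap (dY a * (P * Y)) =
      Bivariate.swap b * (-(Bivariate.swap P * (X * derivative (Bivariate.swap Y))) -
        ((1 - (r : K[X][X])) * (X * derivative (Bivariate.swap P)) + X * Bivariate.swap S) *
          Bivariate.swap Y) := by
    rw [h]
    simp only [map_mul, map_sub, map_neg, map_add, map_one, map_natCast, swap_dY]
    ring
  have h3 : (-(Bivariate.swap P * (X * derivative (Bivariate.swap Y)))).natDegree ≤
      (Bivariate.swap P).natDegree + (Bivariate.swap Y).natDegree := by
    rw [natDegree_neg]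
    exact natDegree_mul_le_of_le le_rfl (natDegree_X_mul_derivative_le _)
  have h4 : ((1 - (r : K[X][X])) * (X * derivative (Bivariate.swap P))).natDegree ≤
      0 + (Bivariate.swap P).natDegree :=
    natDegree_mul_le_of_le hr (natDegree_X_mul_derivative_le _)
  rw [zero_add] at h4
  have h5 := natDegree_mul_le_of_le hb.le ((natDegree_sub_le_of_le h3 (natDegree_mul_le_of_le
    (natDegree_add_le_of_degree_le h4 hS) (le_refl (Bivariate.swap Y).natDegree))))
  rw [← h2, h1] at h5
  omega

/-- If `innerNum` has a nontrivial kernel, then a factor can be split off, or all the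
exponents of the factors depending on the inner variable are nonpositive integers. -/
theorem exists_reduction_of_innerNum_eq_zero [CharZero K] {Y : K[X][X]} {r : ℕ} (hb : b ≠ 0)
    (hs : Squarefree s) (hsb : ∀ q : K[X][X], Prime q → (q ∣ s ↔ q ∣ b)) (hc : ∀ ℓ, c ℓ ≠ 0)
    (hBy : b * By = s * dY b) (hY0 : Y ≠ 0)
    (hY : innerNum (b * s * ∏ ℓ, c ℓ) (logNum dY By a b s c e) r Y = 0) :
    (∃ (q G Mx My : K[X][X]) (n : ℕ), q ≠ 0 ∧ 0 < (Bivariate.swap q).natDegree ∧ n ≤ r - 1 ∧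
      b * s * ∏ ℓ, c ℓ = q * G ∧
      logNum derivative Bx a b s c e = n * (derivative q * G) + q * Mx ∧
      logNum dY By a b s c e = n * (dY q * G) + q * My) ∨
    ((Bivariate.swap a).natDegree = 0 ∧ (Bivariate.swap b).natDegree = 0 ∧
      ∀ ℓ, (Bivariate.swap (c ℓ)).natDegree = 0 ∨ ∃ m : ℕ, e ℓ = -(m : K)) := by
  refine or_iff_not_imp_left.2 fun hno => ?_
  have hno' : ∀ q, Prime q → 0 < (Bivariate.swap q).natDegree → q ∣ b * s * ∏ ℓ, c ℓ →
      q ∣ logNum derivative Bx a b s c e → q ∣ logNum dY By a b s c e → False := by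
    rintro q hq hqy ⟨G, hG⟩ ⟨Mx, hMx⟩ ⟨My, hMy⟩
    exact hno ⟨q, G, Mx, My, 0, hq.ne_zero, hqy, Nat.zero_le _, hG, by simpa using hMx,
      by simpa using hMy⟩
  have hqb : ∀ q, Prime q → 0 < (Bivariate.swap q).natDegree → ¬ q ∣ b := by
    intro q hq hqy hqb
    have hqs := (hsb q hq).2 hqb
    have hqa := dvd_of_innerNum_eq_zero hq hqy hb hqb hqs hs hc hBy hY0 hY
    exact hno' q hq hqy ((hqb.mul_right _).mul_right _) (dvd_logNum_of_dvd _ hqa hqs)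
      (dvd_logNum_of_dvd _ hqa hqs)
  have hby : (Bivariate.swap b).natDegree = 0 := by
    by_contra h
    obtain ⟨q, hq, hd, hqy⟩ := exists_prime_dvd_natDegree_swap_pos b hb (Nat.pos_of_ne_zero h)
    exact hqb q hq hqy hd
  have hsy : (Bivariate.swap s).natDegree = 0 := by
    by_contra h
    obtain ⟨q, hq, hd, hqy⟩ := exists_prime_dvd_natDegree_swap_pos s hs.ne_zero
      (Nat.pos_of_ne_zero h)
    exact hqb q hq hqy ((hsb q hq).1 hd)
  have hdY0 : ∀ p : K[X][X], (Bivariate.swap p).natDegree = 0 → dY p = 0 := by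
    intro p hp
    rw [dY_apply, derivative_of_natDegree_zero hp, map_zero]
  refine ⟨?_, hby, fun ℓ => or_iff_not_imp_left.2 fun hℓ => ?_⟩
  · by_contra hay
    have hBy0 : By = 0 := by
      rw [hdY0 b hby, mul_zero] at hBy
      exact (mul_eq_zero.1 hBy).resolve_left hb
    have hP : ∏ ℓ, c ℓ ≠ 0 := Finset.prod_ne_zero_iff.2 fun ℓ _ => hc ℓ
    have hS : (X * Bivariate.swap (∑ ℓ, e ℓ • (dY (c ℓ) *
        ∏ j ∈ Finset.univ.erase ℓ, c j))).natDegree ≤ (Bivariate.swap (∏ ℓ, c ℓ)).natDegree := by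
      have h := natDegree_logSum_le (c := fun ℓ => Bivariate.swap (c ℓ)) (e := e)
        natDegree_X_mul_derivative_le
      rw [map_prod, natDegree_prod _ _ fun ℓ _ => swap_ne_zero (hc ℓ)]
      convert h using 2
      simp only [map_sum, map_smul, map_mul, map_prod, swap_dY, Finset.mul_sum, mul_smul_comm,
        mul_assoc]
    rw [innerNum_apply, logNum, hBy0, dY.leibniz, dY.leibniz, hdY0 b hby, hdY0 s hsy] at hY
    generalize (∑ ℓ, e ℓ • (dY (c ℓ) * ∏ j ∈ Finset.univ.erase ℓ, c j)) = S at hS hY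
    generalize ∏ ℓ, c ℓ = P at *
    simp only [smul_eq_mul] at hY
    have h : dY a * (P * Y) = b * (-(P * dY Y) - ((1 - (r : K[X][X])) * dY P + S) * Y) := by
      apply mul_left_cancel₀ hs.ne_zero
      linear_combination hY
    exact hay (natDegree_swap_eq_zero_of_dY_mul_eq hby hP hY0 hS h)
  · obtain ⟨q, hq, ⟨c', hc'⟩, hqy⟩ := exists_prime_dvd_natDegree_swap_pos (c ℓ) (hc ℓ)
      (Nat.pos_of_ne_zero hℓ)
    have hqP : q ∣ ∏ ℓ, c ℓ :=
      (Dvd.intro c' hc'.symm).trans (Finset.dvd_prod_of_mem c (Finset.mem_univ ℓ))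
    have hsq : ¬ q ^ 2 ∣ ∏ ℓ, c ℓ := fun h =>
      hno' q hq hqy (hqP.mul_left _) (dvd_logNum_of_sq_dvd dX hq hc h)
        (dvd_logNum_of_sq_dvd dY hq hc h)
    obtain ⟨Mx, hMx⟩ := exists_logNum_eq (B := Bx) (a := a) (b := b) (s := s) (e := e) dX hc'
    obtain ⟨My, hMy⟩ := exists_logNum_eq (B := By) (a := a) (b := b) (s := s) (e := e) dY hc'
    have hPeq : ∏ ℓ, c ℓ = q * (c' * ∏ j ∈ Finset.univ.erase ℓ, c j) := by
      rw [← Finset.mul_prod_erase _ _ (Finset.mem_univ ℓ), hc', mul_assoc]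
    have hG : b * s * ∏ ℓ, c ℓ = q * (b * s * (c' * ∏ j ∈ Finset.univ.erase ℓ, c j)) := by
      rw [hPeq]
      ring
    have hqG : ¬ q ∣ b * s * (c' * ∏ j ∈ Finset.univ.erase ℓ, c j) := by
      intro h
      rcases hq.dvd_or_dvd h with h | h
      · exact hqb q hq hqy ((hq.dvd_or_dvd h).elim id (hsb q hq).1)
      · apply hsq
        rw [hPeq, pow_two]
        exact mul_dvd_mul_left q h
    rw [hG, hMy] at hY
    obtain ⟨k, hk⟩ := exponent_eq_of_innerNum_eq_zero hq hqy hqG hY0 hY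
    rcases Nat.lt_or_ge k r with hkr | hkr
    · obtain ⟨n, rfl⟩ := Nat.exists_eq_add_of_lt hkr
      have he : e ℓ = n := by
        push_cast at hk
        linear_combination hk
      simp only [he, Nat.cast_smul_eq_nsmul, nsmul_eq_mul] at hMx hMy
      exact absurd ⟨q, _, Mx, My, n, hq.ne_zero, hqy, by omega, hG, hMx, hMy⟩ hno
    · obtain ⟨m, rfl⟩ := Nat.exists_eq_add_of_le hkr
      refine ⟨m + 1, ?_⟩
      push_cast at hk ⊢
      linear_combination hk

end Reduction

section Count

/-- The inequality between order and degree as a count of unknowns and equations. -/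
theorem count_of_order_degree_bound {α β γ φ3 dx dy : ℕ} {r d : ℤ} (hα : 1 ≤ α) (hγ : 1 ≤ γ)
    (hφ3 : φ3 ≤ 1) (hβ : β + 1 = γ + φ3) (hr : ((γ : ℚ) + (φ3 : ℚ) - 2) + 1 ≤ (r : ℚ))
    (hd : (((α : ℚ) * (2 * (γ : ℚ) - 1 + (φ3 : ℚ)) - 1) * (r : ℚ) + ((dx : ℚ) + (α : ℚ) * (dy : ℚ)
      + ((γ : ℚ) - 2 + (φ3 : ℚ)) * ((dx : ℚ) + 1 - (α : ℚ))
      - (1 / 2) * max ((γ : ℚ) - 2 + (φ3 : ℚ)) 0 * ((γ : ℚ) + 1 + (φ3 : ℚ)))) /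
        ((r : ℚ) - ((γ : ℚ) + (φ3 : ℚ) - 2)) < (d : ℚ)) :
    β ≤ r.toNat ∧ β - 1 ≤ d.toNat ∧ 0 ≤ d ∧
      2 * (β * (dx + r.toNat * α + d.toNat - (β - 1) - α) + α * (dy + r.toNat * γ + 1) + min β 1) +
        (β - 1) * (β - 1 + 1) < 2 * ((r.toNat + 1) * (d.toNat + 1)) := by
  have hβq : (φ3 : ℚ) = β + 1 - γ := by
    have : ((β + 1 : ℕ) : ℚ) = ((γ + φ3 : ℕ) : ℚ) := by rw [hβ]
    push_cast at this
    linarith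
  rw [hβq] at hr hd
  have hβr : (β : ℤ) ≤ r := by
    have : (β : ℚ) ≤ r := by linarith
    exact_mod_cast this
  lift r to ℕ using (Int.natCast_nonneg β).trans hβr with R
  rw [Int.toNat_natCast]
  have hβR : β ≤ R := by exact_mod_cast hβr
  rw [div_lt_iff₀ (by linarith)] at hd
  have hβγ : γ ≤ β + 1 ∧ β ≤ γ := by omega
  rcases β with _ | w
  · obtain rfl : γ = 1 := by omega
    have hmax : max ((1 : ℕ) - 2 + ((0 : ℕ) + 1 - (1 : ℕ)) : ℚ) 0 = 0 := by norm_num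
    rw [hmax] at hd
    have hd' : (α : ℤ) * (dy + R + 1) < (R + 1) * (d + 1) := by
      push_cast at hd
      have : (α : ℚ) * (dy + R + 1) < (R + 1) * (d + 1) := by linarith
      exact_mod_cast this
    have hd0 : 0 ≤ d := by
      by_contra! hneg
      have h1 : (R + 1 : ℤ) * (d + 1) ≤ 0 :=
        mul_nonpos_of_nonneg_of_nonpos (by positivity) (by omega)
      have h2 : (0 : ℤ) ≤ α * (dy + R + 1) := by positivity
      omega
    lift d to ℕ using hd0 with D
    rw [Int.toNat_natCast]
    refine ⟨hβR, by omega, by omega, ?_⟩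
    norm_cast at hd'
    simpa using hd'
  · have hmax : max ((γ : ℚ) - 2 + (((w + 1 : ℕ) : ℚ) + 1 - γ)) 0 = w := by
      push_cast
      rw [show (γ : ℚ) - 2 + ((w : ℚ) + 1 + 1 - γ) = w by ring]
      exact max_eq_left (by positivity)
    rw [hmax] at hd
    have hd' : 2 * ((w + 1) * ((dx : ℤ) + (R - 1) * α + d - w) + α * (dy + R * γ + 1) + 1) +
        w * (w + 1) < 2 * ((R + 1) * (d + 1)) := by
      push_cast at hd
      have : 2 * ((w + 1) * ((dx : ℚ) + (R - 1) * α + d - w) + α * (dy + R * γ + 1) + 1) +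
        w * (w + 1) < 2 * ((R + 1) * (d + 1)) := by linarith
      exact_mod_cast this
    have hα' : (1 : ℤ) ≤ α := by exact_mod_cast hα
    have hγ' : (w + 1 : ℤ) ≤ γ := by exact_mod_cast hβγ.2
    have hR' : (w + 1 : ℤ) ≤ R := by exact_mod_cast hβR
    have hwd : (w : ℤ) ≤ d := by
      by_contra! hneg
      have h1 : (R - w : ℤ) * (d + 1) ≤ (R - w) * w :=
        mul_le_mul_of_nonneg_left (by omega) (by omega)
      have h2 : (0 : ℤ) ≤ w := by positivity
      have h3 : (w + 1 : ℤ) * (w + 1) ≤ R * γ :=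
        mul_le_mul hR' hγ' (by positivity) (by positivity)
      have h4 : (w + 1 : ℤ) * w ≤ (w + 1) * (R - 1) :=
        mul_le_mul_of_nonneg_left (by omega) (by positivity)
      have h5 : (1 : ℤ) * ((w + 1) * (R - 1) + R * γ + 1) ≤
          α * ((w + 1) * (R - 1) + R * γ + 1) :=
        mul_le_mul_of_nonneg_right hα' (by nlinarith)
      have h6 : (0 : ℤ) ≤ α * dy := by positivity
      have h7 : (0 : ℤ) ≤ (w + 1) * dx := by positivity
      nlinarith
    lift d to ℕ using (Int.natCast_nonneg w).trans hwd with D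
    rw [Int.toNat_natCast]
    have hwD : w ≤ D := by exact_mod_cast hwd
    refine ⟨hβR, by omega, by omega, ?_⟩
    obtain ⟨R', rfl⟩ := Nat.exists_eq_add_of_le' (show 1 ≤ R by omega)
    obtain ⟨D', rfl⟩ := Nat.exists_eq_add_of_le hwD
    rw [Nat.add_sub_cancel, show dx + (R' + 1) * α + (w + D') - w - α = dx + R' * α + D' by
      rw [add_mul]; omega, min_eq_right (by omega)]
    zify
    push_cast at hd'
    linarith

end Count

section Existence

variable {K : Type*} [Field K] {E : Type*} [Field E] {Δx Δy : Derivation ℤ E E}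
  {ι : K[X][X] →+* E} {H : E} {c0 G Mx My : K[X][X]} {α β γ γ' dx dy r d : ℕ}

theorem hasTelescoper_of_count [CharZero K] (hinj : Function.Injective ι)
    (hΔx : ∀ q, Δx (ι q) = ι (derivative q)) (hΔy : ∀ q, Δy (ι q) = ι (dY q))
    (hdata : LogData Δx Δy ι H G Mx My α γ) (hc0 : c0 ≠ 0) (hdx : c0.natDegree ≤ dx)
    (hdy : (Bivariate.swap c0).natDegree ≤ dy)
    (hγ : γ' = γ ∨ γ' + 1 = γ ∧ ∀ Y, innerNum G My r Y = 0 → Y = 0)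
    (hγβ : γ' ≤ β) (hβr : β ≤ r) (hβd : β - 1 ≤ d)
    (hcard : 2 * (γ' * (dx + r * α + d - (β - 1) - α) + α * (dy + r * γ + 1) + min β 1) +
      (β - 1) * (β - 1 + 1) < 2 * ((r + 1) * (d + 1))) :
    HasTelescoper Δx Δy ι (ι c0 * H) r d := by
  have hγr : γ ≤ dy + r * γ + 1 := by
    rcases r with _ | r
    · omega
    · rw [add_mul]
      omega
  rcases β with _ | w
  · obtain rfl : γ' = 0 := by omega
    refine hasTelescoper_of_rectangle hinj hΔx hΔy hdata hc0 hdx hdy hγ hγr ?_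
    simp only [zero_mul] at hcard ⊢
    omega
  · refine hasTelescoper_of_trapezoid hinj hΔx hΔy hdata hc0 hdx hdy hγ hγr hβd ?_
    rwa [min_eq_right (by omega)] at hcard

/-- Splitting off a factor does not increase the number of equations. -/
theorem hasTelescoper_of_reduction [CharZero K] (hinj : Function.Injective ι)
    (hΔx : ∀ q, Δx (ι q) = ι (derivative q)) (hΔy : ∀ q, Δy (ι q) = ι (dY q))
    {q : K[X][X]} {n : ℕ} (hq : q ≠ 0) (hqy : 0 < (Bivariate.swap q).natDegree) (hn : n ≤ r - 1)
    (hdata : LogData Δx Δy ι H (q * G) (n * (derivative q * G) + q * Mx)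
      (n * (dY q * G) + q * My) α γ) (hc0 : c0 ≠ 0) (hγβ : γ = β + 1) (hβr : β ≤ r)
    (hβd : β - 1 ≤ d)
    (hcard : 2 * (β * (c0.natDegree + r * α + d - (β - 1) - α) +
      α * ((Bivariate.swap c0).natDegree + r * γ + 1) + min β 1) +
      (β - 1) * (β - 1 + 1) < 2 * ((r + 1) * (d + 1))) :
    HasTelescoper Δx Δy ι (ι c0 * H) r d := by
  have hιq : ι q ≠ 0 := (map_ne_zero_iff ι hinj).2 hq
  have hG : G ≠ 0 := right_ne_zero_of_mul hdata.ne_zero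
  have hH : ι c0 * H = ι (c0 * q ^ n) * (H / ι q ^ n) := by
    rw [map_mul, map_pow]
    field_simp
  have hqα : q.natDegree ≤ α := by
    have := hdata.degx_G
    rw [natDegree_mul hq hG] at this
    omega
  have hqγ : (Bivariate.swap q).natDegree ≤ γ := by
    have := hdata.degy_G
    rw [natDegree_swap_mul hq hG] at this
    omega
  have hdx : (c0 * q ^ n).natDegree ≤ c0.natDegree + n * q.natDegree :=
    natDegree_mul_le_of_le le_rfl (natDegree_pow_le)
  have hdy : (Bivariate.swap (c0 * q ^ n)).natDegree ≤
      (Bivariate.swap c0).natDegree + n * (Bivariate.swap q).natDegree := by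
    rw [map_mul, map_pow]
    exact natDegree_mul_le_of_le le_rfl natDegree_pow_le
  rw [hH]
  refine hasTelescoper_of_count hinj hΔx hΔy (hdata.reduce hinj hΔx hΔy hq)
    (mul_ne_zero hc0 (pow_ne_zero _ hq)) hdx hdy (Or.inl rfl) (by omega : _ ≤ β) hβr hβd
    (lt_of_le_of_lt ?_ hcard)
  generalize q.natDegree = qx at *
  generalize (Bivariate.swap q).natDegree = qy at *
  obtain ⟨α', rfl⟩ := Nat.exists_eq_add_of_le hqα
  obtain ⟨γ'', hγ''⟩ := Nat.exists_eq_add_of_le hqγ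
  rw [hγ'', Nat.add_sub_cancel_left, Nat.add_sub_cancel_left]
  have hr : n * qy ≤ r * qy := Nat.mul_le_mul_right _ (by omega)
  have h1 : α' * ((Bivariate.swap c0).natDegree + n * qy + r * γ'' + 1) ≤
      (qx + α') * ((Bivariate.swap c0).natDegree + r * (qy + γ'') + 1) :=
    Nat.mul_le_mul (by omega) (by rw [mul_add]; omega)
  have h2 : γ'' * (c0.natDegree + n * qx + r * α' + d - (β - 1) - α') ≤
      β * (c0.natDegree + r * (qx + α') + d - (β - 1) - (qx + α')) := by
    rcases r with _ | r
    · obtain rfl : γ'' = 0 := by omega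
      simp
    · refine Nat.mul_le_mul (by omega) ?_
      have : n * qx ≤ r * qx := Nat.mul_le_mul_right _ (by omega)
      rw [add_mul, add_mul, mul_add]
      omega
  omega

end Existence

theorem thm1_case2
    {K : Type*} {E : Type*} [Field K] [CharZero K] [Field E]
    (Dx Dy : E → E)
    (hDxadd : ∀ u v : E, Dx (u + v) = Dx u + Dx v)
    (hDxmul : ∀ u v : E, Dx (u * v) = Dx u * v + u * Dx v)
    (hDyadd : ∀ u v : E, Dy (u + v) = Dy u + Dy v)
    (hDymul : ∀ u v : E, Dy (u * v) = Dy u * v + u * Dy v)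
    (hcomm : ∀ u : E, Dx (Dy u) = Dy (Dx u))
    (ι : Polynomial (Polynomial K) →+* E)
    (hinj : Function.Injective ι)
    (hDxι : ∀ q : Polynomial (Polynomial K), Dx (ι q) = ι (Polynomial.derivative q))
    (hDyι : ∀ q : Polynomial (Polynomial K), Dy (ι q) = ι (DY q))
    (L : ℕ) (a b c0 bs : Polynomial (Polynomial K))
    (c : Fin L → Polynomial (Polynomial K)) (e : Fin L → K)
    (ha : a ≠ 0) (hb : b ≠ 0) (hc0 : c0 ≠ 0) (hc : ∀ ℓ, c ℓ ≠ 0)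
    (hbs : Squarefree bs)
    (hbsb : ∀ q : Polynomial (Polynomial K), Prime q → (q ∣ bs ↔ q ∣ b))
    (h : E) (hh : h ≠ 0)
    (hDxh : Dx h * ι (c0 * b ^ 2 * (∏ ℓ, c ℓ))
      = h * ι (Polynomial.derivative c0 * b ^ 2 * (∏ ℓ, c ℓ)
          + (Polynomial.derivative a * b - a * Polynomial.derivative b) * c0 * (∏ ℓ, c ℓ)
          + c0 * b ^ 2 * ∑ ℓ, e ℓ • (Polynomial.derivative (c ℓ) * ∏ j ∈ Finset.univ.erase ℓ, c j)))
    (hDyh : Dy h * ι (c0 * b ^ 2 * (∏ ℓ, c ℓ))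
      = h * ι (DY c0 * b ^ 2 * (∏ ℓ, c ℓ)
          + (DY a * b - a * DY b) * c0 * (∏ ℓ, c ℓ)
          + c0 * b ^ 2 * ∑ ℓ, e ℓ • (DY (c ℓ) * ∏ j ∈ Finset.univ.erase ℓ, c j)))
    (hce : ∀ ℓ, e ℓ ≠ 0)
    (hndx : 0 < max a.natDegree b.natDegree + ∑ ℓ, (c ℓ).natDegree)
    (hndy : 0 < max (degY a) (degY b) + ∑ ℓ, degY (c ℓ))
    (hdeg : a.natDegree ≤ b.natDegree)
    (φ3 : ℕ) (hφ3a : φ3 ≤ 1)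
    (hφ3 : φ3 = 1 ↔
      ((∃ a' b' : Polynomial K, b' ≠ 0 ∧ a * liftX b' = b * liftX a') ∧
       (∀ ℓ, degY (c ℓ) = 0 ∨ ∃ n : ℤ, e ℓ = (n : K)) ∧
       (∃ η : ℤ, (η : K) = ∑ ℓ, e ℓ * (degY (c ℓ) : K) ∧ η ≤ (degY c0 : ℤ))))
    (r d : ℤ)
    (hr : (((degY bs : ℚ) + (max (degY a) (degY b) : ℚ) + ∑ ℓ, (degY (c ℓ) : ℚ)) + (φ3 : ℚ) - 2) + 1 ≤ (r : ℚ))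
    (hd : ((((bs.natDegree : ℚ) + (b.natDegree : ℚ) + ∑ ℓ, ((c ℓ).natDegree : ℚ)) * (2 * ((degY bs : ℚ) + (max (degY a) (degY b) : ℚ) + ∑ ℓ, (degY (c ℓ) : ℚ)) - 1 + (φ3 : ℚ)) - 1) * (r : ℚ) + ((c0.natDegree : ℚ) + ((bs.natDegree : ℚ) + (b.natDegree : ℚ) + ∑ ℓ, ((c ℓ).natDegree : ℚ)) * (degY c0 : ℚ)
        + (((degY bs : ℚ) + (max (degY a) (degY b) : ℚ) + ∑ ℓ, (degY (c ℓ) : ℚ)) - 2 + (φ3 : ℚ)) * ((c0.natDegree : ℚ) + 1 - ((bs.natDegree : ℚ) + (b.natDegree : ℚ) + ∑ ℓ, ((c ℓ).natDegree : ℚ)))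
        - (1 / 2) * max (((degY bs : ℚ) + (max (degY a) (degY b) : ℚ) + ∑ ℓ, (degY (c ℓ) : ℚ)) - 2 + (φ3 : ℚ)) 0 * (((degY bs : ℚ) + (max (degY a) (degY b) : ℚ) + ∑ ℓ, (degY (c ℓ) : ℚ)) + 1 + (φ3 : ℚ)))) / ((r : ℚ) - (((degY bs : ℚ) + (max (degY a) (degY b) : ℚ) + ∑ ℓ, (degY (c ℓ) : ℚ)) + (φ3 : ℚ) - 2))
            < (d : ℚ)) :
    ∃ p : ℕ → Polynomial K,
      (∃ i ≤ r.toNat, p i ≠ 0) ∧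
      (∀ i ≤ r.toNat, ((p i).natDegree : ℤ) ≤ d) ∧
      ∃ u v : Polynomial (Polynomial K), v ≠ 0 ∧
        ∑ i ∈ Finset.range (r.toNat + 1), ι (liftX (p i)) * Dx^[i] h
          = Dy (ι u * h / ι v) := by
  simp only [DY_eq_dY] at hDyι hDyh
  simp only [degY_eq_natDegree_swap] at hndy hφ3 hr hd
  let Δx : Derivation ℤ E E := Derivation.mk' (AddMonoidHom.mk' Dx hDxadd).toIntLinearMap
    fun u v => by simp [hDxmul, mul_comm, add_comm]
  let Δy : Derivation ℤ E E := Derivation.mk' (AddMonoidHom.mk' Dy hDyadd).toIntLinearMap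
    fun u v => by simp [hDymul, mul_comm, add_comm]
  obtain ⟨Bx, hBx⟩ := dvd_mul_derivation dX bs b fun q hq => (hbsb q hq).2
  obtain ⟨By, hBy⟩ := dvd_mul_derivation dY bs b fun q hq => (hbsb q hq).2
  have hdata : LogData Δx Δy ι (h / ι c0) (b * bs * ∏ ℓ, c ℓ) (logNum derivative Bx a b bs c e)
      (logNum dY By a b bs c e) _ _ :=
    logData_logNum hb hbs.ne_zero hc hBx.symm hBy.symm hdeg
      (derivation_div_mul_eq Δx ι hinj derivative hDxι hc0 hb hBx.symm hDxh)
      (derivation_div_mul_eq Δy ι hinj dY hDyι hc0 hb hBy.symm hDyh)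
  have hh0 : h = ι c0 * (h / ι c0) := by
    rw [mul_div_cancel₀ _ ((map_ne_zero_iff ι hinj).2 hc0)]
  have hα : 1 ≤ bs.natDegree + b.natDegree + ∑ ℓ, (c ℓ).natDegree := by
    rw [max_eq_right hdeg] at hndx
    omega
  set α := bs.natDegree + b.natDegree + ∑ ℓ, (c ℓ).natDegree with hαdef
  set γ := (Bivariate.swap bs).natDegree +
    max (Bivariate.swap a).natDegree (Bivariate.swap b).natDegree +
    ∑ ℓ, (Bivariate.swap (c ℓ)).natDegree with hγdef
  have hγ : 1 ≤ γ := by omega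
  have hαq : (α : ℚ) = (bs.natDegree : ℚ) + (b.natDegree : ℚ) + ∑ ℓ, ((c ℓ).natDegree : ℚ) := by
    rw [hαdef]
    push_cast
    rfl
  have hγq : (γ : ℚ) = ((Bivariate.swap bs).natDegree : ℚ) +
      (max (Bivariate.swap a).natDegree (Bivariate.swap b).natDegree : ℚ) +
      ∑ ℓ, ((Bivariate.swap (c ℓ)).natDegree : ℚ) := by
    rw [hγdef]
    push_cast
    rfl
  rw [← hγq] at hr
  rw [← hγq, ← hαq] at hd
  obtain ⟨hβr, hβd, hd0, hcard⟩ := count_of_order_degree_bound (β := γ - 1 + φ3) hα hγ hφ3a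
    (by omega) hr hd
  have key : HasTelescoper Δx Δy ι (ι c0 * (h / ι c0)) r.toNat d.toNat := by
    have hcount := hasTelescoper_of_count (β := γ - 1 + φ3) (γ' := γ - 1 + φ3)
      (r := r.toNat) (d := d.toNat) hinj hDxι hDyι hdata hc0 le_rfl le_rfl
    by_cases hφ : φ3 = 1
    · exact hcount (Or.inl (by omega)) le_rfl hβr hβd hcard
    obtain rfl : φ3 = 0 := by omega
    by_cases hker : ∀ Y, innerNum (b * bs * ∏ ℓ, c ℓ) (logNum dY By a b bs c e) r.toNat Y = 0 → Y = 0
    · exact hcount (Or.inr ⟨by omega, hker⟩) le_rfl hβr hβd hcard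
    push Not at hker
    obtain ⟨Y, hY, hY0⟩ := hker
    rcases exists_reduction_of_innerNum_eq_zero (Bx := Bx) hb hbs hbsb hc hBy.symm hY0 hY with
      ⟨q, G, Mx, My, n, hq, hqy, hn, hG, hMx, hMy⟩ | ⟨hay, hby, hcy⟩
    · rw [hG, hMx, hMy] at hdata
      exact hasTelescoper_of_reduction hinj hDxι hDyι hq hqy hn hdata hc0 (by omega) hβr hβd hcard
    · refine absurd (hφ3.2 ⟨?_, fun ℓ => (hcy ℓ).imp_right ?_, ?_⟩) hφ
      · obtain ⟨a', rfl⟩ := exists_liftX_of_natDegree_swap_eq_zero a hay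
        obtain ⟨b', rfl⟩ := exists_liftX_of_natDegree_swap_eq_zero b hby
        refine ⟨a', b', ?_, mul_comm _ _⟩
        rintro rfl
        exact hb (Polynomial.map_zero _)
      · rintro ⟨m, hm⟩
        exact ⟨-m, by rw [hm]; push_cast; rfl⟩
      · have hm : ∀ ℓ, ∃ m : ℕ, e ℓ * ((Bivariate.swap (c ℓ)).natDegree : K) = -(m : K) := by
          intro ℓ
          rcases hcy ℓ with h0 | ⟨m, hm⟩
          · exact ⟨0, by simp [h0]⟩
          · exact ⟨m * (Bivariate.swap (c ℓ)).natDegree, by rw [hm]; push_cast; ring⟩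
        choose m hm using hm
        refine ⟨-((∑ ℓ, m ℓ : ℕ) : ℤ), ?_, by omega⟩
        simp [hm]
  obtain ⟨p, hp0, hpd, u, v, hv, hrel⟩ := key
  rw [← hh0] at hrel
  exact ⟨p, hp0, fun i hi => by have := hpd i hi; omega, u, v, hv, hrel⟩
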